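/- arXiv:2602.14792 — 12 statements merged into one kernel-verified Lean document; each statement's English description precedes it below -/
import Mathlib

section
/- Let q be a positive integer with q ≡ 26 (mod 27). Then there do not exist non-negative integers γ₀, γ₁, γ₂, γ₃ satisfying 4γ₀+γ₁ ≤ q−1, 3γ₁+γ₂ ≤ q−1, 3γ₂+γ₃ ≤ q−1, 3γ₃ ≤ q−1, and γ₀+γ₁+γ₂+γ₃ = q−2. -/
theorem stmt_0 (q : ℕ) (hq : 0 < q) (hmod : q % 27 = 26) :
    ¬ ∃ γ₀ γ₁ γ₂ γ₃ : ℕ,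
      4 * γ₀ + γ₁ ≤ q - 1 ∧
      3 * γ₁ + γ₂ ≤ q - 1 ∧
      3 * γ₂ + γ₃ ≤ q - 1 ∧
      3 * γ₃ ≤ q - 1 ∧
      γ₀ + γ₁ + γ₂ + γ₃ = q - 2 := by
  rintro ⟨a, b, c, d, h₀, h₁, h₂, h₃, hsum⟩
  obtain ⟨m, rfl⟩ : ∃ m, q = 27 * m + 26 := ⟨q / 27, by omega⟩
  -- The four slacks sum to `4`, so the last one, being `1` mod `3`, is `1` or `4`.
  have hd : d = 9 * m + 8 ∨ d = 9 * m + 7 := by omega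
  rcases hd with rfl | rfl
  · have hc : c = 6 * m + 5 := by omega
    omega
  · have hc : c = 6 * m + 6 := by omega
    omega
end

section
/- Let q be a positive integer with q ≢ 1 (mod 27). Then there do not exist non-negative integers γ₀, γ₁, γ₂, γ₃ satisfying 4γ₀+γ₁ ≤ q−1, 3γ₁+γ₂ ≤ q−1, 3γ₂+γ₃ ≤ q−1, 3γ₃ ≤ q−1, and γ₀+γ₁+γ₂+γ₃ = q−1. -/
theorem stmt_1 (q : ℕ) (hq : 0 < q) (hmod : q % 27 ≠ 1) :
    ¬ ∃ γ₀ γ₁ γ₂ γ₃ : ℕ,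
      4 * γ₀ + γ₁ ≤ q - 1 ∧
      3 * γ₁ + γ₂ ≤ q - 1 ∧
      3 * γ₂ + γ₃ ≤ q - 1 ∧
      3 * γ₃ ≤ q - 1 ∧
      γ₀ + γ₁ + γ₂ + γ₃ = q - 1 := by
  rintro ⟨γ₀, γ₁, γ₂, γ₃, h₀, h₁, h₂, h₃, hsum⟩
  have e₀ : 4 * γ₀ + γ₁ = q - 1 := by linarith
  have e₁ : 3 * γ₁ + γ₂ = q - 1 := by linarith
  have e₂ : 3 * γ₂ + γ₃ = q - 1 := by linarith
  have e₃ : 3 * γ₃ = q - 1 := by linarith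
  omega
end

section
/- For all non-negative integers γ₀, γ₁, γ₂, γ₃ with γ₀+γ₁+γ₂+γ₃ = 510 or γ₀+γ₁+γ₂+γ₃ = 511, at least one of the four quantities 4γ₀+γ₁, 3γ₁+γ₂, 3γ₂+γ₃, 3γ₃ is at least 512. -/
theorem stmt_2 (γ₀ γ₁ γ₂ γ₃ : ℕ)
    (h : γ₀ + γ₁ + γ₂ + γ₃ = 510 ∨ γ₀ + γ₁ + γ₂ + γ₃ = 511) :
    512 ≤ 4 * γ₀ + γ₁ ∨ 512 ≤ 3 * γ₁ + γ₂ ∨ 512 ≤ 3 * γ₂ + γ₃ ∨ 512 ≤ 3 * γ₃ := by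
  by_contra! hlt
  obtain ⟨h₀, h₁, h₂, h₃⟩ := hlt
  -- The four quantities add up to `4 * (γ₀ + γ₁ + γ₂ + γ₃) ≥ 2040`, so each is at least `507`.
  have hγ₃ : γ₃ = 169 ∨ γ₃ = 170 := by omega
  have hγ₂ : γ₂ = 113 ∨ γ₂ = 114 := by omega
  omega
end

section
/- For every integer n with 1 ≤ n ≤ 9 and all non-negative integers γ₀, γ₁, γ₂, γ₃ with γ₀+γ₁+γ₂+γ₃ = 2ⁿ−1, at least one of the four quantities 4γ₀+γ₁, 3γ₁+γ₂, 3γ₂+γ₃, 3γ₃ is at least 2ⁿ. -/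
theorem stmt_3 (n : ℕ) (hn1 : 1 ≤ n) (hn9 : n ≤ 9) (γ₀ γ₁ γ₂ γ₃ : ℕ)
    (h : γ₀ + γ₁ + γ₂ + γ₃ = 2 ^ n - 1) :
    2 ^ n ≤ 4 * γ₀ + γ₁ ∨ 2 ^ n ≤ 3 * γ₁ + γ₂ ∨ 2 ^ n ≤ 3 * γ₂ + γ₃ ∨ 2 ^ n ≤ 3 * γ₃ := by
  by_contra! hlt
  obtain ⟨h₀, h₁, h₂, h₃⟩ := hlt
  -- The four quantities sum to `4 * (2 ^ n - 1)`, so each of them equals `2 ^ n - 1`.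
  have e₃ : 3 * γ₃ + 1 = 2 ^ n := by omega
  have e₂ : 3 * γ₂ + γ₃ + 1 = 2 ^ n := by omega
  have e₁ : 3 * γ₁ + γ₂ + 1 = 2 ^ n := by omega
  have hmod : 2 ^ n % 27 = 1 := by omega
  interval_cases n <;> simp at hmod
end

section
/- Let p be a prime with p ≡ 3 (mod 4), and let f = x⁴ + y⁴ + z⁴ + w⁴ in the polynomial ring 𝔽_p[x,y,z,w]. Then f^{p−2} lies in the ideal (x^p, y^p, z^p, w^p). -/
open MvPolynomial

theorem stmt_4 (p : ℕ) (hp : p.Prime) (hmod : p % 4 = 3) :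
    let x : MvPolynomial (Fin 4) (ZMod p) := X 0
    let y : MvPolynomial (Fin 4) (ZMod p) := X 1
    let z : MvPolynomial (Fin 4) (ZMod p) := X 2
    let w : MvPolynomial (Fin 4) (ZMod p) := X 3
    let f : MvPolynomial (Fin 4) (ZMod p) := x ^ 4 + y ^ 4 + z ^ 4 + w ^ 4
    f ^ (p - 2) ∈ Ideal.span {x ^ p, y ^ p, z ^ p, w ^ p} := by
  intro x y z w f
  obtain ⟨k, rfl⟩ : ∃ k, p = 4 * k + 3 := ⟨p / 4, by omega⟩
  have h := Ideal.sum_pow_mem_span_pow Finset.univ ![x ^ 4, y ^ 4, z ^ 4, w ^ 4] k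
  have hf : ∑ i, ![x ^ 4, y ^ 4, z ^ 4, w ^ 4] i = f := by simp [Fin.sum_univ_four, f]
  rw [hf, Finset.card_univ, Fintype.card_fin] at h
  refine Ideal.span_le.2 ?_ h
  have hdvd (t : MvPolynomial (Fin 4) (ZMod (4 * k + 3))) :
      t ^ (4 * k + 3) ∣ (t ^ 4) ^ (k + 1) := by
    rw [← pow_mul]
    exact pow_dvd_pow t (by omega)
  rintro _ ⟨i, -, rfl⟩
  fin_cases i <;>
    exact Ideal.mem_of_dvd _ (hdvd _) (Ideal.subset_span (by simp))
end

section
/- Let f = x⁴ + x·y³ + z⁴ + z·w³ in the polynomial ring 𝔽₅[x,y,z,w]. Then f³ lies in the ideal (x⁵, y⁵, z⁵, w⁵). -/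
open MvPolynomial

/-- The square of `a ^ 4 + a * b ^ 3` lies in every ideal containing `a ^ 5` and `b ^ 5`. -/
theorem sq_mem_of_pow_five_mem {R : Type*} [CommRing R] {I : Ideal R} {a b : R}
    (ha : a ^ 5 ∈ I) (hb : b ^ 5 ∈ I) : (a ^ 4 + a * b ^ 3) ^ 2 ∈ I := by
  have h : (a ^ 4 + a * b ^ 3) ^ 2 = (a ^ 3 + 2 * b ^ 3) * a ^ 5 + a ^ 2 * b * b ^ 5 := by ring
  rw [h]
  exact I.add_mem (I.mul_mem_left _ ha) (I.mul_mem_left _ hb)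

theorem stmt_5 :
    let x : MvPolynomial (Fin 4) (ZMod 5) := X 0
    let y : MvPolynomial (Fin 4) (ZMod 5) := X 1
    let z : MvPolynomial (Fin 4) (ZMod 5) := X 2
    let w : MvPolynomial (Fin 4) (ZMod 5) := X 3
    let f : MvPolynomial (Fin 4) (ZMod 5) := x ^ 4 + x * y ^ 3 + z ^ 4 + z * w ^ 3
    f ^ 3 ∈ Ideal.span {x ^ 5, y ^ 5, z ^ 5, w ^ 5} := by
  intro x y z w f
  have hxy : (x ^ 4 + x * y ^ 3) ^ 2 ∈ Ideal.span {x ^ 5, y ^ 5, z ^ 5, w ^ 5} :=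
    sq_mem_of_pow_five_mem (Ideal.subset_span (by simp)) (Ideal.subset_span (by simp))
  have hzw : (z ^ 4 + z * w ^ 3) ^ 2 ∈ Ideal.span {x ^ 5, y ^ 5, z ^ 5, w ^ 5} :=
    sq_mem_of_pow_five_mem (Ideal.subset_span (by simp)) (Ideal.subset_span (by simp))
  have h : f ^ 3 =
      (x ^ 4 + x * y ^ 3 + 3 * (z ^ 4 + z * w ^ 3)) * (x ^ 4 + x * y ^ 3) ^ 2 +
        (3 * (x ^ 4 + x * y ^ 3) + (z ^ 4 + z * w ^ 3)) * (z ^ 4 + z * w ^ 3) ^ 2 := by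
    simp only [f]
    ring
  rw [h]
  exact Ideal.add_mem _ (Ideal.mul_mem_left _ _ hxy) (Ideal.mul_mem_left _ _ hzw)
end

section
/- Let f = x⁴ + x·y³ + z⁴ + z·w³ in the polynomial ring 𝔽₅[x,y,z,w]. Then the radical of the ideal generated by f together with its four partial derivatives ∂f/∂x = 4x³ + y³, ∂f/∂y = 3xy², ∂f/∂z = 4z³ + w³, ∂f/∂w = 3zw² equals the maximal ideal (x, y, z, w). (This is the Jacobian criterion showing that f defines a smooth quartic surface in ℙ³ in characteristic 5.) -/
open MvPolynomial

/-- In characteristic `5`, the common zero locus of the partial derivatives of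
`a ^ 4 + a * b ^ 3` is `a = b = 0`. -/
theorem Ideal.mem_radical_of_quartic_partials {R : Type*} [CommRing R] [CharP R 5] {I : Ideal R}
    {a b : R} (ha : 4 * a ^ 3 + b ^ 3 ∈ I) (hb : 3 * a * b ^ 2 ∈ I) :
    a ∈ I.radical ∧ b ∈ I.radical := by
  have h5 : (5 : R) = 0 := by exact_mod_cast CharP.cast_eq_zero R 5
  refine ⟨⟨4, ?_⟩, ⟨5, ?_⟩⟩
  · convert I.add_mem (I.mul_mem_left (4 * a) ha) (I.mul_mem_left (2 * b) hb) using 1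
    linear_combination -(3 * a ^ 4 + 2 * a * b ^ 3) * h5
  · convert I.add_mem (I.mul_mem_left (b ^ 2) ha) (I.mul_mem_left (2 * a ^ 2) hb) using 1
    linear_combination -(2 * a ^ 3 * b ^ 2) * h5

theorem MvPolynomial.ker_constantCoeff_eq_idealOfVars (σ R : Type*) [CommRing R] :
    RingHom.ker (constantCoeff : MvPolynomial σ R →+* R) = idealOfVars σ R := by
  ext p
  rw [RingHom.mem_ker, ← pow_one (idealOfVars σ R), mem_pow_idealOfVars_iff']
  simp [Finsupp.degree_eq_zero_iff, constantCoeff_eq]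

theorem stmt_6 :
    let x : MvPolynomial (Fin 4) (ZMod 5) := X 0
    let y : MvPolynomial (Fin 4) (ZMod 5) := X 1
    let z : MvPolynomial (Fin 4) (ZMod 5) := X 2
    let w : MvPolynomial (Fin 4) (ZMod 5) := X 3
    let f : MvPolynomial (Fin 4) (ZMod 5) := x ^ 4 + x * y ^ 3 + z ^ 4 + z * w ^ 3
    (Ideal.span {f, pderiv 0 f, pderiv 1 f, pderiv 2 f, pderiv 3 f}).radical =
      Ideal.span {x, y, z, w} := by
  intro x y z w f
  have : Fact (Nat.Prime 5) := ⟨Nat.prime_five⟩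
  have hx : pderiv 0 f = 4 * x ^ 3 + y ^ 3 := by
    simp [f, x, y, z, w, pderiv_X, Derivation.leibniz_pow]
  have hy : pderiv 1 f = 3 * x * y ^ 2 := by
    simp [f, x, y, z, w, pderiv_X, Derivation.leibniz_pow]
    ring
  have hz : pderiv 2 f = 4 * z ^ 3 + w ^ 3 := by
    simp [f, x, y, z, w, pderiv_X, Derivation.leibniz_pow]
  have hw : pderiv 3 f = 3 * z * w ^ 2 := by
    simp [f, x, y, z, w, pderiv_X, Derivation.leibniz_pow]
    ring
  have hvars : Ideal.span {x, y, z, w} =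
      RingHom.ker (constantCoeff : MvPolynomial (Fin 4) (ZMod 5) →+* ZMod 5) := by
    rw [ker_constantCoeff_eq_idealOfVars, idealOfVars]
    congr 1
    ext p
    simp [Fin.exists_fin_succ, x, y, z, w, eq_comm]
  rw [hx, hy, hz, hw]
  apply le_antisymm
  · rw [hvars, (RingHom.ker_isPrime _).radical_le_iff, Ideal.span_le]
    simp [Set.insert_subset_iff, RingHom.mem_ker, f, x, y, z, w]
  · have hxy := Ideal.mem_radical_of_quartic_partials (a := x) (b := y)
      (I := Ideal.span {f, 4 * x ^ 3 + y ^ 3, 3 * x * y ^ 2, 4 * z ^ 3 + w ^ 3, 3 * z * w ^ 2})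
      (Ideal.subset_span (by simp)) (Ideal.subset_span (by simp))
    have hzw := Ideal.mem_radical_of_quartic_partials (a := z) (b := w)
      (I := Ideal.span {f, 4 * x ^ 3 + y ^ 3, 3 * x * y ^ 2, 4 * z ^ 3 + w ^ 3, 3 * z * w ^ 2})
      (Ideal.subset_span (by simp)) (Ideal.subset_span (by simp))
    simp [Ideal.span_le, Set.insert_subset_iff, hxy, hzw]
end

section
/- Let f = x⁴ + x·y³ + y·z³ + z·w³ in the polynomial ring 𝔽₂[x,y,z,w]. Then the radical of the ideal generated by f together with its four partial derivatives ∂f/∂x = y³, ∂f/∂y = xy² + z³, ∂f/∂z = yz² + w³, ∂f/∂w = zw² equals the maximal ideal (x, y, z, w). (This is the Jacobian criterion showing that f defines a smooth quartic surface in ℙ³ in characteristic 2.) -/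
open MvPolynomial

/-- A radical ideal containing the quartic `x⁴ + xy³ + yz³ + zw³` and the values in characteristic
two of its partial derivatives by `x`, `y` and `z` contains `x`, `y`, `z` and `w`. -/
lemma mem_of_quartic_mem {R : Type*} [CommRing R] {K : Ideal R} (hK : K.IsRadical)
    {x y z w : R} (hf : x ^ 4 + x * y ^ 3 + y * z ^ 3 + z * w ^ 3 ∈ K) (hx : y ^ 3 ∈ K)
    (hy : x * y ^ 2 + z ^ 3 ∈ K) (hz : y * z ^ 2 + w ^ 3 ∈ K) :
    x ∈ K ∧ y ∈ K ∧ z ∈ K ∧ w ∈ K := by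
  have y_mem : y ∈ K := hK ⟨3, hx⟩
  have z_mem : z ∈ K := hK ⟨3, by
    convert K.sub_mem hy (K.mul_mem_left (x * y) y_mem) using 1; ring⟩
  have w_mem : w ∈ K := hK ⟨3, by
    convert K.sub_mem hz (K.mul_mem_left (z ^ 2) y_mem) using 1; ring⟩
  have x_mem : x ∈ K := hK ⟨4, by
    convert K.sub_mem hf (K.add_mem (K.mul_mem_left (x * y ^ 2 + z ^ 3) y_mem)
      (K.mul_mem_left (w ^ 3) z_mem)) using 1; ring⟩
  exact ⟨x_mem, y_mem, z_mem, w_mem⟩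

/-- The ideal generated by the variables consists of the polynomials without constant term. -/
lemma idealOfVars_eq_ker_constantCoeff (σ R : Type*) [CommRing R] :
    idealOfVars σ R = RingHom.ker (constantCoeff (σ := σ) (R := R)) := by
  ext p
  rw [idealOfVars, ← Set.image_univ, mem_ideal_span_X_image, RingHom.mem_ker,
    constantCoeff_eq, ← notMem_support_iff]
  simp only [Set.mem_univ, true_and]
  exact ⟨fun h h0 ↦ by simpa using h 0 h0,
    fun h m hm ↦ Finsupp.ne_iff.mp (ne_of_mem_of_not_mem hm h)⟩

lemma idealOfVars_fin_four (R : Type*) [CommRing R] :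
    idealOfVars (Fin 4) R = Ideal.span {X 0, X 1, X 2, X 3} := by
  rw [idealOfVars]
  congr 1
  ext p
  simp [Fin.exists_fin_succ, eq_comm]

theorem stmt_7 :
    let x : MvPolynomial (Fin 4) (ZMod 2) := X 0
    let y : MvPolynomial (Fin 4) (ZMod 2) := X 1
    let z : MvPolynomial (Fin 4) (ZMod 2) := X 2
    let w : MvPolynomial (Fin 4) (ZMod 2) := X 3
    let f : MvPolynomial (Fin 4) (ZMod 2) := x ^ 4 + x * y ^ 3 + y * z ^ 3 + z * w ^ 3
    (Ideal.span {f, pderiv 0 f, pderiv 1 f, pderiv 2 f, pderiv 3 f}).radical =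
      Ideal.span {x, y, z, w} := by
  intro x y z w f
  have two_eq_zero : (2 : MvPolynomial (Fin 4) (ZMod 2)) = 0 := CharTwo.two_eq_zero
  have hx : pderiv 0 f = y ^ 3 := by
    simp only [f, x, y, z, w, map_add, Derivation.leibniz, Derivation.leibniz_pow, pderiv_X_self,
      pderiv_X_of_ne, smul_eq_mul, nsmul_eq_mul, ne_eq, Fin.reduceEq, not_false_eq_true]
    push_cast
    linear_combination (2 * x ^ 3) * two_eq_zero
  have hy : pderiv 1 f = x * y ^ 2 + z ^ 3 := by
    simp only [f, x, y, z, w, map_add, Derivation.leibniz, Derivation.leibniz_pow, pderiv_X_self,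
      pderiv_X_of_ne, smul_eq_mul, nsmul_eq_mul, ne_eq, Fin.reduceEq, not_false_eq_true]
    push_cast
    linear_combination (x * y ^ 2) * two_eq_zero
  have hz : pderiv 2 f = y * z ^ 2 + w ^ 3 := by
    simp only [f, x, y, z, w, map_add, Derivation.leibniz, Derivation.leibniz_pow, pderiv_X_self,
      pderiv_X_of_ne, smul_eq_mul, nsmul_eq_mul, ne_eq, Fin.reduceEq, not_false_eq_true]
    push_cast
    linear_combination (y * z ^ 2) * two_eq_zero
  have hw : pderiv 3 f = z * w ^ 2 := by
    simp only [f, x, y, z, w, map_add, Derivation.leibniz, Derivation.leibniz_pow, pderiv_X_self,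
      pderiv_X_of_ne, smul_eq_mul, nsmul_eq_mul, ne_eq, Fin.reduceEq, not_false_eq_true]
    push_cast
    linear_combination (z * w ^ 2) * two_eq_zero
  rw [hx, hy, hz, hw]
  apply le_antisymm
  · rw [← idealOfVars_fin_four, idealOfVars_eq_ker_constantCoeff,
      (RingHom.ker_isPrime _).radical_le_iff, Ideal.span_le]
    simp [Set.insert_subset_iff, RingHom.mem_ker, f, x, y, z, w]
  · obtain ⟨x_mem, y_mem, z_mem, w_mem⟩ := mem_of_quartic_mem
      (Ideal.radical_isRadical (Ideal.span
        {f, y ^ 3, x * y ^ 2 + z ^ 3, y * z ^ 2 + w ^ 3, z * w ^ 2}))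
      (x := x) (y := y) (z := z) (w := w)
      (Ideal.le_radical (Ideal.subset_span (by simp [f])))
      (Ideal.le_radical (Ideal.subset_span (by simp)))
      (Ideal.le_radical (Ideal.subset_span (by simp)))
      (Ideal.le_radical (Ideal.subset_span (by simp)))
    simp [Ideal.span_le, Set.insert_subset_iff, x_mem, y_mem, z_mem, w_mem]
end

section
/- Let f = x⁴ + x·y³ + y·z³ + z·w³ in 𝔽₂[x,y,z,w], and let Δ(f) = x⁵y³ + x⁴yz³ + x⁴zw³ + xy⁴z³ + xy³zw³ + yz⁴w³ (the sum of the pairwise products of the four monomials of f). Then Δ(f)^{2⁸−1} = Δ(f)^{255} lies in the ideal (x^{512}, y^{512}, z^{512}, w^{512}). -/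
open MvPolynomial

section TruncatedPowers

variable {R : Type*} [CommRing R]

/-- The ideal generated by the `q`-th powers of four elements. -/
def powIdeal (x y z w : R) (q : ℕ) : Ideal R :=
  Ideal.span {x ^ q, y ^ q, z ^ q, w ^ q}

/-- The monomial `x ^ a * y ^ b * z ^ c * w ^ d` if all its exponents are below `q`,
and `0` otherwise. -/
def truncMonomial (x y z w : R) (q a b c d : ℕ) : R :=
  if a < q ∧ b < q ∧ c < q ∧ d < q then x ^ a * y ^ b * z ^ c * w ^ d else 0

/-- The polynomial `Δ(x⁴ + xy³ + yz³ + zw³)` in characteristic two. -/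
def deltaQuartic (x y z w : R) : R :=
  x ^ 5 * y ^ 3 + x ^ 4 * y * z ^ 3 + x ^ 4 * z * w ^ 3 +
    x * y ^ 4 * z ^ 3 + x * y ^ 3 * z * w ^ 3 + y * z ^ 4 * w ^ 3

variable (x y z w : R)

theorem monomial_sub_truncMonomial_mem (q a b c d : ℕ) :
    x ^ a * y ^ b * z ^ c * w ^ d - truncMonomial x y z w q a b c d ∈ powIdeal x y z w q := by
  have pow_mem {u : R} {e : ℕ} (hu : u ^ q ∈ powIdeal x y z w q) (he : q ≤ e) :
      u ^ e ∈ powIdeal x y z w q := Ideal.mem_of_dvd _ (pow_dvd_pow u he) hu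
  unfold truncMonomial
  split_ifs with h
  · simp
  · rw [sub_zero]
    have h' : q ≤ a ∨ q ≤ b ∨ q ≤ c ∨ q ≤ d := by omega
    rcases h' with h' | h' | h' | h'
    · exact Ideal.mul_mem_right _ _ (Ideal.mul_mem_right _ _ (Ideal.mul_mem_right _ _
        (pow_mem (Ideal.subset_span (by simp)) h')))
    · exact Ideal.mul_mem_right _ _ (Ideal.mul_mem_right _ _ (Ideal.mul_mem_left _ _
        (pow_mem (Ideal.subset_span (by simp)) h')))
    · exact Ideal.mul_mem_right _ _ (Ideal.mul_mem_left _ _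
        (pow_mem (Ideal.subset_span (by simp)) h'))
    · exact Ideal.mul_mem_left _ _ (pow_mem (Ideal.subset_span (by simp)) h')

theorem deltaQuartic_mul_sq_sub_mem (q a b c d : ℕ) :
    deltaQuartic x y z w * (x ^ a * y ^ b * z ^ c * w ^ d) ^ 2 -
      (truncMonomial x y z w q (2 * a + 5) (2 * b + 3) (2 * c) (2 * d) +
        truncMonomial x y z w q (2 * a + 4) (2 * b + 1) (2 * c + 3) (2 * d) +
        truncMonomial x y z w q (2 * a + 4) (2 * b) (2 * c + 1) (2 * d + 3) +
        truncMonomial x y z w q (2 * a + 1) (2 * b + 4) (2 * c + 3) (2 * d) +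
        truncMonomial x y z w q (2 * a + 1) (2 * b + 3) (2 * c + 1) (2 * d + 3) +
        truncMonomial x y z w q (2 * a) (2 * b + 1) (2 * c + 4) (2 * d + 3)) ∈
      powIdeal x y z w q := by
  have h := monomial_sub_truncMonomial_mem x y z w q
  convert add_mem (add_mem (add_mem (add_mem (add_mem
    (h (2 * a + 5) (2 * b + 3) (2 * c) (2 * d))
    (h (2 * a + 4) (2 * b + 1) (2 * c + 3) (2 * d)))
    (h (2 * a + 4) (2 * b) (2 * c + 1) (2 * d + 3)))
    (h (2 * a + 1) (2 * b + 4) (2 * c + 3) (2 * d)))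
    (h (2 * a + 1) (2 * b + 3) (2 * c + 1) (2 * d + 3)))
    (h (2 * a) (2 * b + 1) (2 * c + 4) (2 * d + 3)) using 1
  unfold deltaQuartic
  ring

variable {x y z w} [CharP R 2]

theorem sq_mem_powIdeal {q : ℕ} {u : R} (hu : u ∈ powIdeal x y z w q) :
    u ^ 2 ∈ powIdeal x y z w (2 * q) := by
  have h := Ideal.mem_map_of_mem (frobenius R 2) hu
  simpa [powIdeal, Ideal.map_span, Set.image_insert_eq, frobenius_def, ← pow_mul,
    mul_comm q 2] using h

theorem pow_two_mul_add_one_sub_mem {q q' n n' : ℕ} {g m m' : R}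
    (h : g ^ n - m ∈ powIdeal x y z w q) (hq : q' = 2 * q) (hn : n' = 2 * n + 1)
    (h' : g * m ^ 2 - m' ∈ powIdeal x y z w q') :
    g ^ n' - m' ∈ powIdeal x y z w q' := by
  subst hq hn
  convert add_mem (Ideal.mul_mem_left _ g (sq_mem_powIdeal h)) h' using 1
  rw [CharTwo.sub_eq_add (g ^ n) m, CharTwo.add_sq]
  linear_combination -(g * m ^ 2) * CharTwo.two_eq_zero (R := R)

variable (x y z w)

theorem deltaQuartic_pow_255_mem :
    deltaQuartic x y z w ^ 255 ∈ powIdeal x y z w 512 := by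
  have step := deltaQuartic_mul_sq_sub_mem x y z w
  have h₁ : deltaQuartic x y z w ^ 1 - x ^ 1 * y ^ 3 * z ^ 1 * w ^ 3 ∈ powIdeal x y z w 4 := by
    simpa [truncMonomial] using step 4 0 0 0 0
  have h₂ : deltaQuartic x y z w ^ 3 - x ^ 6 * y ^ 7 * z ^ 5 * w ^ 6 ∈ powIdeal x y z w 8 :=
    pow_two_mul_add_one_sub_mem h₁ (by norm_num) (by norm_num)
      (by simpa [truncMonomial] using step 8 1 3 1 3)
  have h₃ : deltaQuartic x y z w ^ 7 - x ^ 12 * y ^ 15 * z ^ 14 * w ^ 15 ∈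
      powIdeal x y z w 16 :=
    pow_two_mul_add_one_sub_mem h₂ (by norm_num) (by norm_num)
      (by simpa [truncMonomial] using step 16 6 7 5 6)
  have h₄ : deltaQuartic x y z w ^ 15 - x ^ 28 * y ^ 31 * z ^ 31 * w ^ 30 ∈
      powIdeal x y z w 32 :=
    pow_two_mul_add_one_sub_mem h₃ (by norm_num) (by norm_num)
      (by simpa [truncMonomial] using step 32 12 15 14 15)
  have h₅ : deltaQuartic x y z w ^ 31 - x ^ 60 * y ^ 62 * z ^ 63 * w ^ 63 ∈
      powIdeal x y z w 64 :=
    pow_two_mul_add_one_sub_mem h₄ (by norm_num) (by norm_num)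
      (by simpa [truncMonomial] using step 64 28 31 31 30)
  have h₆ : deltaQuartic x y z w ^ 63 - x ^ 125 * y ^ 127 * z ^ 126 * w ^ 126 ∈
      powIdeal x y z w 128 :=
    pow_two_mul_add_one_sub_mem h₅ (by norm_num) (by norm_num)
      (by simpa [truncMonomial] using step 128 60 62 63 63)
  have h₇ : deltaQuartic x y z w ^ 127 - (x ^ 254 * y ^ 255 * z ^ 255 * w ^ 252 +
      x ^ 254 * y ^ 254 * z ^ 253 * w ^ 255) ∈ powIdeal x y z w 256 :=
    pow_two_mul_add_one_sub_mem h₆ (by norm_num) (by norm_num)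
      (by simpa [truncMonomial] using step 256 125 127 126 126)
  have h₈ : deltaQuartic x y z w ^ 255 - 0 ∈ powIdeal x y z w 512 := by
    refine pow_two_mul_add_one_sub_mem h₇ (by norm_num) (by norm_num) ?_
    rw [CharTwo.add_sq, mul_add, sub_zero]
    exact add_mem (by simpa [truncMonomial] using step 512 254 255 255 252)
      (by simpa [truncMonomial] using step 512 254 254 253 255)
  simpa using h₈

end TruncatedPowers

theorem stmt_8 :
    let x : MvPolynomial (Fin 4) (ZMod 2) := X 0
    let y : MvPolynomial (Fin 4) (ZMod 2) := X 1
    let z : MvPolynomial (Fin 4) (ZMod 2) := X 2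
    let w : MvPolynomial (Fin 4) (ZMod 2) := X 3
    let Δf : MvPolynomial (Fin 4) (ZMod 2) :=
      x ^ 5 * y ^ 3 + x ^ 4 * y * z ^ 3 + x ^ 4 * z * w ^ 3 +
        x * y ^ 4 * z ^ 3 + x * y ^ 3 * z * w ^ 3 + y * z ^ 4 * w ^ 3
    Δf ^ 255 ∈ Ideal.span {x ^ 512, y ^ 512, z ^ 512, w ^ 512} := by
  intro x y z w Δf
  exact deltaQuartic_pow_255_mem x y z w
end

section
/- Let f = x⁴ + x·y³ + y·z³ + z·w³ in 𝔽₂[x,y,z,w], and let Δ(f) = x⁵y³ + x⁴yz³ + x⁴zw³ + xy⁴z³ + xy³zw³ + yz⁴w³ (the sum of the pairwise products of the four monomials of f). Then for every integer n with 1 ≤ n ≤ 9, the polynomial f·Δ(f)^{2^{n−1}−1} lies in the ideal (x^{2ⁿ}, y^{2ⁿ}, z^{2ⁿ}, w^{2ⁿ}). -/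
open MvPolynomial

/-- A polynomial all of whose monomials are divisible by some `X i ^ q` lies in the ideal generated
by the `q`-th powers of the variables. -/
theorem MvPolynomial.mem_span_X_pow_of_forall_support {σ R : Type*} [CommSemiring R] {q : ℕ}
    {g : MvPolynomial σ R} (h : ∀ m ∈ g.support, ∃ i, q ≤ m i) :
    g ∈ Ideal.span (Set.range fun i : σ => (X i : MvPolynomial σ R) ^ q) := by
  rw [g.as_sum]
  refine Ideal.sum_mem _ fun m hm => ?_
  obtain ⟨i, hi⟩ := h m hm
  refine Ideal.mem_of_dvd _ ?_ (Ideal.subset_span (Set.mem_range_self i))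
  simp only [X_pow_eq_monomial, monomial_dvd_monomial]
  exact ⟨Or.inr (Finsupp.single_le_iff.mpr hi), one_dvd _⟩

/-- A homogeneous polynomial in four variables of degree `4 * (q - 1)` which is weighted homogeneous
of degree zero for weights at which `(X 0 * X 1 * X 2 * X 3) ^ (q - 1)` has nonzero degree lies in
the ideal generated by the `q`-th powers of the variables. -/
theorem MvPolynomial.IsHomogeneous.mem_span_X_pow {R M : Type*} [CommSemiring R]
    [AddCommMonoid M] {N : ℕ} {wt : Fin 4 → M} {g : MvPolynomial (Fin 4) R}
    (hg : g.IsHomogeneous (4 * N)) (hw : IsWeightedHomogeneous wt g 0)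
    (hN : N • ∑ i, wt i ≠ 0) :
    g ∈ Ideal.span (Set.range fun i : Fin 4 => (X i : MvPolynomial (Fin 4) R) ^ (N + 1)) := by
  refine mem_span_X_pow_of_forall_support fun m hm => ?_
  by_contra! hlt
  have hdeg : m 0 + m 1 + m 2 + m 3 = 4 * N := by
    have := hg (mem_support_iff.mp hm)
    rw [Finsupp.weight_apply, Finsupp.sum_fintype _ _ (by simp)] at this
    simpa [Fin.sum_univ_four] using this
  have heq : ∀ i, m i = N := by
    have h0 := hlt 0
    have h1 := hlt 1
    have h2 := hlt 2
    have h3 := hlt 3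
    intro i
    fin_cases i <;> simp <;> omega
  apply hN
  rw [← hw (mem_support_iff.mp hm), Finsupp.weight_apply, Finsupp.sum_fintype _ _ (by simp)]
  simp [heq, Finset.smul_sum]

/-- The weights in `ℤ/27` for which `x⁴`, `xy³`, `yz³` and `zw³` all have degree zero. -/
def quarticWeight : Fin 4 → ZMod 27 := ![0, 9, 24, 1]

theorem stmt_9 :
    let x : MvPolynomial (Fin 4) (ZMod 2) := X 0
    let y : MvPolynomial (Fin 4) (ZMod 2) := X 1
    let z : MvPolynomial (Fin 4) (ZMod 2) := X 2
    let w : MvPolynomial (Fin 4) (ZMod 2) := X 3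
    let f : MvPolynomial (Fin 4) (ZMod 2) := x ^ 4 + x * y ^ 3 + y * z ^ 3 + z * w ^ 3
    let Δf : MvPolynomial (Fin 4) (ZMod 2) :=
      x ^ 5 * y ^ 3 + x ^ 4 * y * z ^ 3 + x ^ 4 * z * w ^ 3 +
        x * y ^ 4 * z ^ 3 + x * y ^ 3 * z * w ^ 3 + y * z ^ 4 * w ^ 3
    ∀ n : ℕ, 1 ≤ n → n ≤ 9 →
      f * Δf ^ (2 ^ (n - 1) - 1) ∈
        Ideal.span {x ^ 2 ^ n, y ^ 2 ^ n, z ^ 2 ^ n, w ^ 2 ^ n} := by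
  intro x y z w f Δf n hn1 hn9
  have hquartic : ∀ {M : Type} [AddCommMonoid M] (wt : Fin 4 → M) (d : M),
      4 • wt 0 = d → wt 0 + 3 • wt 1 = d → wt 1 + 3 • wt 2 = d → wt 2 + 3 • wt 3 = d →
      IsWeightedHomogeneous wt f d ∧ IsWeightedHomogeneous wt Δf (2 • d) := by
    intro M _ wt d hA hB hC hD
    have hX := isWeightedHomogeneous_X (ZMod 2) wt
    have A : IsWeightedHomogeneous wt (x ^ 4) d := hA ▸ (hX 0).pow 4
    have B : IsWeightedHomogeneous wt (x * y ^ 3) d := hB ▸ (hX 0).mul ((hX 1).pow 3)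
    have C : IsWeightedHomogeneous wt (y * z ^ 3) d := hC ▸ (hX 1).mul ((hX 2).pow 3)
    have D : IsWeightedHomogeneous wt (z * w ^ 3) d := hD ▸ (hX 2).mul ((hX 3).pow 3)
    refine ⟨((A.add B).add C).add D, ?_⟩
    have hΔ : Δf = x ^ 4 * (x * y ^ 3) + x ^ 4 * (y * z ^ 3) + x ^ 4 * (z * w ^ 3) +
        x * y ^ 3 * (y * z ^ 3) + x * y ^ 3 * (z * w ^ 3) + y * z ^ 3 * (z * w ^ 3) := by
      simp only [Δf]
      ring
    rw [hΔ, two_nsmul]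
    exact (((((A.mul B).add (A.mul C)).add (A.mul D)).add (B.mul C)).add (B.mul D)).add (C.mul D)
  obtain ⟨hf, hΔf⟩ := hquartic (1 : Fin 4 → ℕ) 4 rfl rfl rfl rfl
  obtain ⟨hf', hΔf'⟩ := hquartic quarticWeight 0 (by decide) (by decide) (by decide) (by decide)
  have hpow : 2 ^ n = 2 * 2 ^ (n - 1) := by
    rw [← pow_succ', Nat.sub_add_cancel hn1]
  have hpos : 0 < 2 ^ (n - 1) := by positivity
  have hmem := IsHomogeneous.mem_span_X_pow (N := 2 ^ n - 1) (wt := quarticWeight)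
    (g := f * Δf ^ (2 ^ (n - 1) - 1))
    (by
      have h := hf.mul (hΔf.pow (2 ^ (n - 1) - 1))
      rwa [show 4 + (2 ^ (n - 1) - 1) • 2 • 4 = 4 * (2 ^ n - 1) by
        simp only [smul_eq_mul]; omega] at h)
    (by simpa using hf'.mul (hΔf'.pow (2 ^ (n - 1) - 1)))
    (by
      rw [show ∑ i, quarticWeight i = ((34 : ℕ) : ZMod 27) by decide, nsmul_eq_mul,
        ← Nat.cast_mul, Ne, ZMod.natCast_eq_zero_iff]
      interval_cases n <;> norm_num)
  rw [Nat.sub_add_cancel Nat.one_le_two_pow] at hmem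
  refine Ideal.span_mono ?_ hmem
  rintro _ ⟨i, rfl⟩
  fin_cases i <;> simp [x, y, z, w]
end

section
/- Let p be a prime with p ≡ 1 (mod 4) and p > 5, and let K be an algebraic closure of 𝔽_p. Then there exists λ ∈ K such that, setting f = x⁴ + y⁴ + z⁴ + w⁴ + λ·xyzw in K[x,y,z,w], one has: (i) f^{p−2} lies in the ideal (x^p, y^p, z^p, w^p), and (ii) the radical of the ideal generated by f together with its four partial derivatives equals the maximal ideal (x, y, z, w) (so f defines a smooth quartic surface in ℙ³). -/
section Hypergeometric

open Polynomial

/-- The coefficient `(4j)! / (j!)^4` of the hypergeometric series attached to the quartic. -/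
noncomputable def quarticCoeff (K : Type*) [Field K] (j : ℕ) : K :=
  ((4 * j).factorial : K) / (j.factorial : K) ^ 4

/-- The truncation at degree `m` of the hypergeometric series attached to the quartic. -/
noncomputable def quarticSeries (K : Type*) [Field K] (m : ℕ) : K[X] :=
  ∑ j ∈ Finset.range (m + 1), Polynomial.C (quarticCoeff K j) * Polynomial.X ^ j

theorem Polynomial.coeff_X_mul_derivative {R : Type*} [CommRing R] (P : R[X]) (n : ℕ) :
    (Polynomial.X * derivative P).coeff n = n * P.coeff n := by
  cases n with
  | zero => simp
  | succ n => rw [coeff_X_mul, coeff_derivative]; push_cast; ring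

theorem Polynomial.natDegree_X_mul_derivative_le {R : Type*} [CommRing R] {P : R[X]} {m : ℕ}
    (h : P.natDegree ≤ m) : (Polynomial.X * derivative P).natDegree ≤ m := by
  rw [natDegree_le_iff_coeff_eq_zero] at h ⊢
  intro n hn
  rw [coeff_X_mul_derivative, h n hn, mul_zero]

variable {K : Type*} [Field K]

theorem quarticSeries_coeff (m n : ℕ) :
    (quarticSeries K m).coeff n = if n ≤ m then quarticCoeff K n else 0 := by
  simp [quarticSeries, Polynomial.coeff_C_mul, Polynomial.coeff_X_pow]

theorem quarticCoeff_zero : quarticCoeff K 0 = 1 := by simp [quarticCoeff]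

theorem quarticCoeff_one : quarticCoeff K 1 = 24 := by
  simp [quarticCoeff, Nat.factorial]

theorem quarticSeries_natDegree_le (m : ℕ) : (quarticSeries K m).natDegree ≤ m := by
  rw [natDegree_le_iff_coeff_eq_zero]
  intro n hn
  rw [quarticSeries_coeff, if_neg (by omega)]

variable {p : ℕ} [hp : Fact p.Prime] [CharP K p]

theorem cast_factorial_ne_zero {n : ℕ} (h : n < p) : (n.factorial : K) ≠ 0 := by
  rw [Ne, CharP.cast_eq_zero_iff K p, hp.out.dvd_factorial]
  omega

omit hp in
theorem cast_ne_zero_of_lt {n : ℕ} (h0 : 0 < n) (h : n < p) : (n : K) ≠ 0 := by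
  rw [Ne, CharP.cast_eq_zero_iff K p]
  exact Nat.not_dvd_of_pos_of_lt h0 h

theorem cast_factorial_mul_factorial {j : ℕ} (h : j < p) :
    ((p - 1 - j).factorial : K) * (j.factorial : K) = (-1) ^ (j + 1) := by
  induction j with
  | zero =>
    have := congrArg (ZMod.castHom (dvd_refl p) K) (ZMod.wilsons_lemma p)
    rw [map_natCast, map_neg, map_one] at this
    simpa only [Nat.sub_zero, Nat.factorial_zero, Nat.cast_one, mul_one, zero_add, pow_one]
      using this
  | succ j ih =>
    have ih := ih (by omega)
    obtain ⟨r, rfl⟩ : ∃ r, p = r + 1 + j + 1 := ⟨p - j - 2, by omega⟩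
    have e1 : r + 1 + j + 1 - 1 - j = r + 1 := by omega
    have e2 : r + 1 + j + 1 - 1 - (j + 1) = r := by omega
    rw [e1, Nat.factorial_succ] at ih
    rw [e2, Nat.factorial_succ]
    have hc : ((r + 1 + j + 1 : ℕ) : K) = 0 := CharP.cast_eq_zero K _
    push_cast at *
    rw [pow_succ, ← ih]
    linear_combination (r.factorial : K) * (j.factorial : K) * hc

theorem quarticCoeff_succ {j : ℕ} (h : j + 1 < p) :
    ((j : K) + 1) ^ 3 * quarticCoeff K (j + 1) =
      4 * (4 * j + 1) * (4 * j + 2) * (4 * j + 3) * quarticCoeff K j := by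
  have h1 : (j.factorial : K) ≠ 0 := cast_factorial_ne_zero (p := p) (by omega)
  have h2 : (j : K) + 1 ≠ 0 := by
    exact_mod_cast cast_ne_zero_of_lt (K := K) (p := p) (n := j + 1) (by omega) h
  have e : 4 * (j + 1) = 4 * j + 1 + 1 + 1 + 1 := by ring
  simp only [quarticCoeff, e, Nat.factorial_succ]
  push_cast
  field_simp
  ring

theorem quarticSeries_ode {m : ℕ} (hm : p = 4 * m + 1) :
    let θ : K[X] → K[X] := fun P => Polynomial.X * derivative P
    let T := quarticSeries K m
    θ (θ (θ T)) - Polynomial.X * (256 * θ (θ (θ T)) + 384 * θ (θ T) + 176 * θ T + 24 * T) = 0 := by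
  intro θ T
  have hm0 : m ≠ 0 := by rintro rfl; exact hp.out.ne_one (by omega)
  have hc : (4 * m + 1 : K) = 0 := by
    have := CharP.cast_eq_zero K p
    rw [hm] at this; exact_mod_cast this
  ext n
  cases n with
  | zero => simp [θ]
  | succ n =>
    have h256 (P : K[X]) : (256 * P).coeff n = 256 * P.coeff n := coeff_ofNat_mul (a := 256)
    have h384 (P : K[X]) : (384 * P).coeff n = 384 * P.coeff n := coeff_ofNat_mul (a := 384)
    have h176 (P : K[X]) : (176 * P).coeff n = 176 * P.coeff n := coeff_ofNat_mul (a := 176)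
    have h24 (P : K[X]) : (24 * P).coeff n = 24 * P.coeff n := coeff_ofNat_mul (a := 24)
    rw [coeff_sub, coeff_X_mul (_ + _)]
    simp only [coeff_add, h256, h384, h176, h24, θ, coeff_X_mul_derivative, T,
      quarticSeries_coeff, Polynomial.coeff_zero]
    rcases lt_trichotomy n m with h | rfl | h
    · rw [if_pos (by omega), if_pos (by omega)]
      have := quarticCoeff_succ (K := K) (p := p) (j := n) (by omega)
      push_cast
      linear_combination this
    · rw [if_neg (by omega), if_pos le_rfl]
      linear_combination (-4 * (4 * n + 2) * (4 * n + 3) * quarticCoeff K n) * hc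
    · rw [if_neg (by omega), if_neg (by omega)]
      ring

/-- The first integral of the differential equation of `quarticSeries` (a symmetric square)
vanishes. -/
theorem quarticSeries_first_integral {m : ℕ} (hm : p = 4 * m + 1) :
    let θ : K[X] → K[X] := fun P => Polynomial.X * derivative P
    let T := quarticSeries K m
    (1 - 256 * Polynomial.X) * (2 * T * θ (θ T) - θ T ^ 2) - 256 * Polynomial.X * T * θ T
      - 48 * Polynomial.X * T ^ 2 = 0 := by
  intro θ T
  have hm0 : m ≠ 0 := by rintro rfl; exact hp.out.ne_one (by omega)
  have ode : θ (θ (θ T)) - Polynomial.X *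
    (256 * θ (θ (θ T)) + 384 * θ (θ T) + 176 * θ T + 24 * T) = 0 := quarticSeries_ode hm
  set E := (1 - 256 * Polynomial.X) * (2 * T * θ (θ T) - θ T ^ 2)
    - 256 * Polynomial.X * T * θ T - 48 * Polynomial.X * T ^ 2 with hE
  have hmul (P Q : K[X]) : θ (P * Q) = θ P * Q + P * θ Q := by
    simp only [θ, derivative_mul]; ring
  have hsub (P Q : K[X]) : θ (P - Q) = θ P - θ Q := by
    simp only [θ, derivative_sub]; ring
  have hX : θ Polynomial.X = Polynomial.X := by simp [θ]
  have h1 : θ 1 = 0 := by simp [θ]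
  have h2 : θ 2 = 0 := by simp [θ]
  have h48 : θ 48 = 0 := by simp [θ]
  have h256 : θ 256 = 0 := by simp [θ]
  have hθE : θ E = 0 := by
    rw [hE]
    simp only [pow_two, hmul, hsub, hX, h1, h2, h48, h256]
    linear_combination (2 * T) * ode
  have hT : T.natDegree ≤ m := quarticSeries_natDegree_le m
  have hT1 : (θ T).natDegree ≤ m := natDegree_X_mul_derivative_le hT
  have hT2 : (θ (θ T)).natDegree ≤ m := natDegree_X_mul_derivative_le hT1
  have hdeg : E.natDegree ≤ 1 + (m + m) := by
    have a1 : (1 - 256 * Polynomial.X : K[X]).natDegree ≤ 1 := by compute_degree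
    have a2 : (256 * Polynomial.X : K[X]).natDegree ≤ 1 := by compute_degree
    have a3 : (48 * Polynomial.X : K[X]).natDegree ≤ 1 := by compute_degree
    have a4 : (2 * T).natDegree ≤ 0 + m :=
      natDegree_mul_le_of_le (by compute_degree) hT
    have a5 : (2 * T * θ (θ T)).natDegree ≤ m + m :=
      (natDegree_mul_le_of_le a4 hT2).trans (by omega)
    rw [hE, mul_assoc (256 * Polynomial.X) T, pow_two, pow_two]
    refine natDegree_sub_le_of_le (natDegree_sub_le_of_le (natDegree_mul_le_of_le a1
      (natDegree_sub_le_of_le a5 (natDegree_mul_le_of_le hT1 hT1)))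
      (natDegree_mul_le_of_le a2 (natDegree_mul_le_of_le hT hT1)))
      (natDegree_mul_le_of_le a3 (natDegree_mul_le_of_le hT hT)) |>.trans ?_
    simp
  ext n
  rw [Polynomial.coeff_zero]
  rcases Nat.eq_zero_or_pos n with rfl | hn
  · simp [hE, θ, coeff_zero_eq_eval_zero]
  · rcases lt_or_ge n p with h | h
    · have := congrArg (fun P => P.coeff n) hθE
      simp only [θ, coeff_X_mul_derivative, Polynomial.coeff_zero] at this
      exact (mul_eq_zero.mp this).resolve_left (cast_ne_zero_of_lt (p := p) hn h)
    · exact coeff_eq_zero_of_natDegree_lt (by omega)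

theorem quarticSeries_exists_root [IsAlgClosed K] {m : ℕ} (hm : p = 4 * m + 1) (hp5 : 5 < p) :
    ∃ t : K, t ≠ 0 ∧ 256 * t ≠ 1 ∧ (quarticSeries K m).IsRoot t := by
  have h2 : (2 : K) ≠ 0 := by
    exact_mod_cast cast_ne_zero_of_lt (K := K) (p := p) (n := 2) (by omega) (by omega)
  have h5 : (5 : K) ≠ 0 := by
    exact_mod_cast cast_ne_zero_of_lt (K := K) (p := p) (n := 5) (by omega) (by omega)
  have h256 : (256 : K) ≠ 0 := by
    rw [show (256 : K) = 2 ^ 8 by norm_num]; exact pow_ne_zero _ h2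
  have hc : (4 * m + 1 : K) = 0 := by
    have := CharP.cast_eq_zero K p
    rw [hm] at this; exact_mod_cast this
  by_contra! hcon
  set T := quarticSeries K m with hT
  have hT0 : T.coeff 0 = 1 := by rw [hT, quarticSeries_coeff, if_pos (by omega), quarticCoeff_zero]
  have hT1 : T.coeff 1 = 24 := by rw [hT, quarticSeries_coeff, if_pos (by omega), quarticCoeff_one]
  have hTm : T.coeff m ≠ 0 := by
    rw [hT, quarticSeries_coeff, if_pos le_rfl, quarticCoeff]
    exact div_ne_zero (cast_factorial_ne_zero (p := p) (by omega))
      (pow_ne_zero _ (cast_factorial_ne_zero (p := p) (by omega)))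
  have hdeg : T.natDegree = m :=
    le_antisymm (quarticSeries_natDegree_le m) (le_natDegree_of_ne_zero hTm)
  have hroots : T.roots = Multiset.replicate m (256⁻¹ : K) := by
    rw [Multiset.eq_replicate]
    refine ⟨by rw [← (IsAlgClosed.splits T).natDegree_eq_card_roots, hdeg], fun t ht => ?_⟩
    have hr : T.IsRoot t := isRoot_of_mem_roots ht
    have ht0 : t ≠ 0 := by
      rintro rfl
      rw [IsRoot, ← coeff_zero_eq_eval_zero, hT0] at hr
      exact one_ne_zero hr
    by_contra h
    refine hcon t ht0 (fun h' => h ?_) hr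
    exact eq_inv_of_mul_eq_one_right h'
  have hprod := (IsAlgClosed.splits T).eq_prod_roots
  rw [hroots, Multiset.map_replicate, Multiset.prod_replicate] at hprod
  obtain ⟨k, rfl⟩ : ∃ k, m = k + 1 := ⟨m - 1, by omega⟩
  have e0 := congrArg (fun P => P.eval 0) hprod
  have e1 := congrArg (fun P => (derivative P).eval 0) hprod
  have hT0' : T.eval 0 = 1 := by rw [← coeff_zero_eq_eval_zero, hT0]
  have hT1' : (derivative T).eval 0 = 24 := by
    rw [← coeff_zero_eq_eval_zero, coeff_derivative, zero_add, hT1]; simp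
  simp only [hT0', hT1', derivative_mul, derivative_C, derivative_X_sub_C_pow] at e0 e1
  simp at e0 e1
  push_cast at hc
  set L := T.leadingCoeff
  have key : (24 : K) * (-(256)⁻¹) = k + 1 := by
    rw [pow_succ] at e0
    linear_combination (-(256)⁻¹) * e1 - (k + 1 : K) * e0
  have : (5 : K) * 2 ^ 5 = 0 := by
    field_simp at key
    linear_combination 4 * key + 256 * hc
  exact mul_ne_zero h5 (pow_ne_zero _ h2) this

theorem exists_double_root [IsAlgClosed K] {m : ℕ} (hm : p = 4 * m + 1) (hp5 : 5 < p) :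
    ∃ t : K, t ≠ 0 ∧ 256 * t ≠ 1 ∧
      ∑ j ∈ Finset.range (m + 1), quarticCoeff K j * t ^ j = 0 ∧
      ∑ j ∈ Finset.range (m + 1), (j : K) * quarticCoeff K j * t ^ j = 0 := by
  obtain ⟨t, ht0, ht1, hr⟩ := quarticSeries_exists_root (K := K) hm hp5
  refine ⟨t, ht0, ht1, ?_, ?_⟩
  · simpa [IsRoot, quarticSeries, eval_finsetSum] using hr
  · have hE := congrArg (eval t) (quarticSeries_first_integral (K := K) hm)
    have hr' : eval t (quarticSeries K m) = 0 := hr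
    simp [hr', ht0] at hE
    have hd : eval t (derivative (quarticSeries K m)) = 0 :=
      hE.resolve_left fun h => ht1 (by linear_combination -h)
    have hX : t * eval t (derivative (quarticSeries K m)) = 0 := by rw [hd, mul_zero]
    simp only [quarticSeries, derivative_sum, eval_finsetSum, Finset.mul_sum] at hX
    rw [← hX]
    refine Finset.sum_congr rfl fun j _ => ?_
    cases j with
    | zero => simp
    | succ j => simp; ring

end Hypergeometric

section Expansion

open MvPolynomial

variable {K : Type*} [Field K]

/-- The quartic form `x⁴ + y⁴ + z⁴ + w⁴ + λxyzw` of the Dwork pencil. -/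
noncomputable def dworkQuartic (lam : K) : MvPolynomial (Fin 4) K :=
  X 0 ^ 4 + X 1 ^ 4 + X 2 ^ 4 + X 3 ^ 4 + C lam * (X 0 * X 1 * X 2 * X 3)

theorem coeff_dworkQuartic_pow (lam : K) (n : ℕ) (d : Fin 4 →₀ ℕ) :
    coeff d (dworkQuartic lam ^ n) =
      ∑ k ∈ Finset.piAntidiag (Finset.univ : Finset (Option (Fin 4))) n,
        if ∀ i, 4 * k (some i) + k none = d i then
          (Nat.multinomial Finset.univ k : K) * lam ^ k none else 0 := by
  have hf : dworkQuartic lam =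
      ∑ o : Option (Fin 4), o.elim (C lam * ∏ i, X i) (fun i => X i ^ 4) := by
    simp [dworkQuartic, Fintype.sum_option, Fin.sum_univ_four, Fin.prod_univ_four]
    ring
  rw [hf, Finset.sum_pow_eq_sum_piAntidiag, coeff_sum]
  refine Finset.sum_congr rfl fun k _ => ?_
  have hmon : (∏ o : Option (Fin 4),
      (o.elim (C lam * ∏ i, X i) (fun i => X i ^ 4) : MvPolynomial (Fin 4) K) ^ k o) =
      monomial (Finsupp.equivFunOnFinite.symm fun i => 4 * k (some i) + k none)
        (lam ^ k none) := by
    rw [monomial_eq, Finsupp.prod_fintype _ _ (by simp), Fintype.prod_option]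
    simp only [Option.elim, mul_pow, ← Finset.prod_pow, Finsupp.equivFunOnFinite_symm_apply_apply,
      pow_add, Finset.prod_mul_distrib, ← pow_mul, C_pow]
    ring
  rw [hmon, ← C_eq_coe_nat, coeff_C_mul, coeff_monomial]
  have : (Finsupp.equivFunOnFinite.symm (fun i => 4 * k (some i) + k none) = d) ↔
      ∀ i, 4 * k (some i) + k none = d i := by
    rw [DFunLike.ext_iff]; rfl
  simp only [this, mul_ite, mul_zero]

theorem mem_span_frobenius_iff (p : ℕ) (f : MvPolynomial (Fin 4) K) :
    f ∈ Ideal.span {X 0 ^ p, X 1 ^ p, X 2 ^ p, X 3 ^ p} ↔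
      ∀ d : Fin 4 →₀ ℕ, (∀ i, d i < p) → coeff d f = 0 := by
  have hset : ({X 0 ^ p, X 1 ^ p, X 2 ^ p, X 3 ^ p} : Set (MvPolynomial (Fin 4) K)) =
      (fun s => monomial s 1) '' Set.range fun i : Fin 4 => Finsupp.single i p := by
    ext g
    simp [Fin.exists_fin_succ, X_pow_eq_monomial, eq_comm]
  rw [hset, mem_ideal_span_monomial_image]
  refine forall_congr' fun d => ?_
  simp only [Set.exists_range_iff, Finsupp.single_le_iff, mem_support_iff]
  rw [← not_imp_not]
  simp

variable {p : ℕ} [hp : Fact p.Prime] [CharP K p]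

theorem multinomial_cast (k : Option (Fin 4) → ℕ)
    (h : ∑ o, k o < p) :
    (Nat.multinomial Finset.univ k : K) =
      ((∑ o, k o).factorial : K) / ∏ o, ((k o).factorial : K) := by
  have h1 := congrArg (Nat.cast : ℕ → K) (Nat.multinomial_spec (Finset.univ) k)
  push_cast at h1
  rw [← h1, mul_div_cancel_left₀]
  refine Finset.prod_ne_zero_iff.mpr fun o _ => cast_factorial_ne_zero (p := p) ?_
  exact (Finset.single_le_sum (fun _ _ => Nat.zero_le _) (Finset.mem_univ o)).trans_lt h

theorem factorial_sub_two (hp2 : 2 < p) : ((p - 2).factorial : K) = 1 := by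
  simpa [Nat.sub_sub] using cast_factorial_mul_factorial (K := K) (p := p) (j := 1) (by omega)

theorem coeff_dworkQuartic_pow_diag {m : ℕ} (hm : p = 4 * m + 1) {lam t : K} (ht : lam ^ 4 * t = 1)
    {d : Fin 4 →₀ ℕ} (hd : ∀ i, d i = p - 2) :
    coeff d (dworkQuartic lam ^ (p - 2)) =
      lam ^ (p - 2) * ∑ j ∈ Finset.range (m + 1), (4 * (j : K) + 1) * quarticCoeff K j * t ^ j := by
  have hm0 : m ≠ 0 := by rintro rfl; exact hp.out.ne_one (by omega)
  have hc : (4 * m + 1 : K) = 0 := by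
    have := CharP.cast_eq_zero K p
    rw [hm] at this; exact_mod_cast this
  rw [coeff_dworkQuartic_pow, Finset.sum_range_succ, hc]
  simp only [zero_mul, add_zero, Finset.mul_sum]
  symm
  refine Finset.sum_of_injOn (fun a o => o.elim (p - 2 - 4 * a) fun _ => a) ?_ ?_ ?_ ?_
  · intro a _ b _ h
    exact congrFun h (some 0)
  · intro a ha
    simp only [Finset.coe_range, Set.mem_Iio] at ha
    simp only [Finset.mem_coe, Finset.mem_piAntidiag, Fintype.sum_option, Option.elim]
    simp
    omega
  · intro k hk hk'
    rw [if_neg]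
    intro h
    simp only [Finset.mem_piAntidiag, Fintype.sum_option, Fin.sum_univ_four] at hk
    have h0 := h 0; have h1 := h 1; have h2 := h 2; have h3 := h 3
    rw [hd] at h0 h1 h2 h3
    refine hk' ⟨k (some 0), ?_, ?_⟩
    · simp only [Finset.coe_range, Set.mem_Iio]; omega
    · funext o
      rcases o with _ | i
      · simp only [Option.elim]; omega
      · simp only [Option.elim]
        have := h i; rw [hd] at this; omega
  · intro a ha
    rw [Finset.mem_range] at ha
    have hsum : ∑ o : Option (Fin 4), (o.elim (p - 2 - 4 * a) fun _ => a) = p - 2 := by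
      simp [Fintype.sum_option]; omega
    rw [if_pos (by intro i; rw [hd]; simp only [Option.elim]; omega),
      multinomial_cast (p := p) _ (by rw [hsum]; omega), hsum, factorial_sub_two (by omega)]
    simp only [Fintype.prod_option, Fin.prod_univ_four, Option.elim]
    have h1 : (a.factorial : K) ≠ 0 := cast_factorial_ne_zero (p := p) (by omega)
    have h2 : ((p - 2 - 4 * a).factorial : K) ≠ 0 := cast_factorial_ne_zero (p := p) (by omega)
    have h3 := cast_factorial_mul_factorial (K := K) (p := p) (j := 4 * a + 1) (by omega)
    rw [show p - 1 - (4 * a + 1) = p - 2 - 4 * a by omega, Nat.factorial_succ,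
      Even.neg_one_pow ⟨2 * a + 1, by ring⟩] at h3
    have h4 : lam ^ (p - 2) = lam ^ (p - 2 - 4 * a) * (lam ^ 4) ^ a := by
      rw [← pow_mul, ← pow_add]; congr 1; omega
    have h5 : (lam ^ 4) ^ a * t ^ a = 1 := by rw [← mul_pow, ht, one_pow]
    rw [h4, quarticCoeff]
    push_cast at h3
    field_simp
    linear_combination (lam ^ (p - 2 - 4 * a) * (lam ^ 4) ^ a * t ^ a) * h3 +
      lam ^ (p - 2 - 4 * a) * h5

theorem coeff_dworkQuartic_pow_off_diag {m : ℕ} (hm : p = 4 * m + 1) {lam t : K}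
    (ht : lam ^ 4 * t = 1) {d : Fin 4 →₀ ℕ} (i : Fin 4) (hi : d i = p - 5)
    (hd : ∀ j ≠ i, d j = p - 1) :
    coeff d (dworkQuartic lam ^ (p - 2)) =
      - lam ^ (p - 1) * ∑ j ∈ Finset.range (m + 1), (j : K) * quarticCoeff K j * t ^ j := by
  have hm0 : m ≠ 0 := by rintro rfl; exact hp.out.ne_one (by omega)
  rw [coeff_dworkQuartic_pow, Finset.sum_range_succ']
  simp only [Nat.cast_zero, zero_mul, add_zero, Finset.mul_sum]
  have hsum (a : ℕ) : ∑ j : Fin 4, (if j = i then a else a + 1) = 4 * a + 3 := by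
    fin_cases i <;> simp [Fin.sum_univ_four] <;> ring
  symm
  refine Finset.sum_of_injOn
    (fun a o => o.elim (p - 1 - 4 * (a + 1)) fun j => if j = i then a else a + 1) ?_ ?_ ?_ ?_
  · intro a _ b _ h
    simpa using congrFun h (some i)
  · intro a ha
    simp only [Finset.coe_range, Set.mem_Iio] at ha
    simp only [Finset.mem_coe, Finset.mem_piAntidiag, Fintype.sum_option, Option.elim, hsum]
    simp
    omega
  · intro k hk hk'
    rw [if_neg]
    intro h
    simp only [Finset.mem_piAntidiag, Fintype.sum_option] at hk
    have h0 := h i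
    rw [hi] at h0
    have hk1 (j : Fin 4) : k (some j) = if j = i then k (some i) else k (some i) + 1 := by
      split_ifs with hj
      · rw [hj]
      · have := h j; rw [hd j hj] at this; omega
    have hk2 : ∑ j, k (some j) = 4 * k (some i) + 3 := by
      rw [← hsum]; exact Finset.sum_congr rfl fun j _ => hk1 j
    refine hk' ⟨k (some i), ?_, ?_⟩
    · simp only [Finset.coe_range, Set.mem_Iio]; omega
    · funext o
      rcases o with _ | j
      · simp only [Option.elim]; omega
      · exact (hk1 j).symm
  · intro a ha
    rw [Finset.mem_range] at ha
    have hsum' : ∑ o : Option (Fin 4),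
        (o.elim (p - 1 - 4 * (a + 1)) fun j => if j = i then a else a + 1) = p - 2 := by
      simp only [Fintype.sum_option, Option.elim, hsum]; omega
    rw [if_pos, multinomial_cast (p := p) _ (by rw [hsum']; omega), hsum',
      factorial_sub_two (by omega)]
    · have hprod : ∏ j : Fin 4, (((if j = i then a else a + 1).factorial : ℕ) : K) =
          a.factorial * (a + 1).factorial ^ 3 := by
        fin_cases i <;> simp [Fin.prod_univ_four] <;> ring
      simp only [Fintype.prod_option, Option.elim, hprod]
      have h1 : (a.factorial : K) ≠ 0 := cast_factorial_ne_zero (p := p) (by omega)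
      have h1' : (a + 1 : K) ≠ 0 := by
        exact_mod_cast cast_ne_zero_of_lt (K := K) (p := p) (n := a + 1) (by omega) (by omega)
      have h2 : ((p - 1 - 4 * (a + 1)).factorial : K) ≠ 0 :=
        cast_factorial_ne_zero (p := p) (by omega)
      have h3 := cast_factorial_mul_factorial (K := K) (p := p) (j := 4 * (a + 1)) (by omega)
      rw [Odd.neg_one_pow ⟨2 * (a + 1), by ring⟩] at h3
      have h4 : lam ^ (p - 1) = lam ^ (p - 1 - 4 * (a + 1)) * (lam ^ 4) ^ (a + 1) := by
        rw [← pow_mul, ← pow_add]; congr 1; omega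
      have h5 : (lam ^ 4) ^ (a + 1) * t ^ (a + 1) = 1 := by rw [← mul_pow, ht, one_pow]
      rw [h4, quarticCoeff, Nat.factorial_succ a]
      push_cast
      generalize ((p - 1 - 4 * (a + 1)).factorial : K) = u at *
      generalize ((4 * (a + 1)).factorial : K) = v at *
      generalize lam ^ (p - 1 - 4 * (a + 1)) = l at *
      generalize (lam ^ 4) ^ (a + 1) = M at *
      generalize t ^ (a + 1) = N at *
      field_simp
      linear_combination (-l * M * N) * h3 + l * h5
    · intro j
      simp only [Option.elim]
      split_ifs with hj
      · rw [hj, hi]; omega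
      · rw [hd j hj]; omega

theorem exponents_eq (a b c d e m : ℕ) (ha : 4 * a + e ≤ 4 * m) (hb : 4 * b + e ≤ 4 * m)
    (hc : 4 * c + e ≤ 4 * m) (hd : 4 * d + e ≤ 4 * m) (hsum : a + b + c + d + e + 1 = 4 * m) :
    (a = b ∧ a = c ∧ a = d ∧ 4 * a + e + 1 = 4 * m) ∨
    (b = a + 1 ∧ c = a + 1 ∧ d = a + 1 ∧ 4 * a + e + 4 = 4 * m) ∨
    (a = b + 1 ∧ c = b + 1 ∧ d = b + 1 ∧ 4 * b + e + 4 = 4 * m) ∨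
    (a = c + 1 ∧ b = c + 1 ∧ d = c + 1 ∧ 4 * c + e + 4 = 4 * m) ∨
    (a = d + 1 ∧ b = d + 1 ∧ c = d + 1 ∧ 4 * d + e + 4 = 4 * m) := by
  obtain ⟨s, hs⟩ := Nat.exists_eq_add_of_le ha
  obtain ⟨t, ht⟩ := Nat.exists_eq_add_of_le hb
  obtain ⟨u, hu⟩ := Nat.exists_eq_add_of_le hc
  obtain ⟨v, hv⟩ := Nat.exists_eq_add_of_le hd
  have hsum4 : s + t + u + v = 4 := by omega
  have key : s = 1 ∧ t = 1 ∧ u = 1 ∧ v = 1 ∨ s = 4 ∧ t = 0 ∧ u = 0 ∧ v = 0 ∨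
      s = 0 ∧ t = 4 ∧ u = 0 ∧ v = 0 ∨ s = 0 ∧ t = 0 ∧ u = 4 ∧ v = 0 ∨
      s = 0 ∧ t = 0 ∧ u = 0 ∧ v = 4 := by
    have hst : s % 4 = t % 4 := by omega
    have hsu : s % 4 = u % 4 := by omega
    have hsv : s % 4 = v % 4 := by omega
    have hs4 : s ≤ 4 := by omega
    clear hs ht hu hv ha hb hc hd hsum
    have aux (n : ℕ) (hn : n ≤ 4) (h : s % 4 = n % 4) : n = s ∨ s = 0 ∧ n = 4 ∨ s = 4 ∧ n = 0 := by
      omega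
    have ht' := aux t (by omega) hst
    have hu' := aux u (by omega) hsu
    have hv' := aux v (by omega) hsv
    clear aux hst hsu hsv
    have hs4 : s ≤ 4 := by omega
    interval_cases s <;> simp at ht' hu' hv' <;> omega
  rcases key with h | h | h | h | h <;> obtain ⟨rfl, rfl, rfl, rfl⟩ := h
  · exact Or.inl (by omega)
  · exact Or.inr (Or.inl (by omega))
  · exact Or.inr (Or.inr (Or.inl (by omega)))
  · exact Or.inr (Or.inr (Or.inr (Or.inl (by omega))))
  · exact Or.inr (Or.inr (Or.inr (Or.inr (by omega))))

theorem dworkQuartic_pow_mem {m : ℕ} (hm : p = 4 * m + 1) {lam t : K} (ht : lam ^ 4 * t = 1)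
    (h0 : ∑ j ∈ Finset.range (m + 1), quarticCoeff K j * t ^ j = 0)
    (h1 : ∑ j ∈ Finset.range (m + 1), (j : K) * quarticCoeff K j * t ^ j = 0) :
    dworkQuartic lam ^ (p - 2) ∈
      Ideal.span {(X 0 : MvPolynomial (Fin 4) K) ^ p, X 1 ^ p, X 2 ^ p, X 3 ^ p} := by
  have hm0 : m ≠ 0 := by rintro rfl; exact hp.out.ne_one (by omega)
  rw [mem_span_frobenius_iff]
  intro d hd
  by_cases hdiag : ∀ i, d i = p - 2
  · rw [coeff_dworkQuartic_pow_diag hm ht hdiag]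
    have : ∑ j ∈ Finset.range (m + 1), (4 * (j : K) + 1) * quarticCoeff K j * t ^ j =
        4 * ∑ j ∈ Finset.range (m + 1), (j : K) * quarticCoeff K j * t ^ j +
          ∑ j ∈ Finset.range (m + 1), quarticCoeff K j * t ^ j := by
      rw [Finset.mul_sum, ← Finset.sum_add_distrib]
      exact Finset.sum_congr rfl fun j _ => by ring
    rw [this, h0, h1]; ring
  by_cases hoff : ∃ i, d i = p - 5 ∧ ∀ j ≠ i, d j = p - 1
  · obtain ⟨i, hi, hj⟩ := hoff
    rw [coeff_dworkQuartic_pow_off_diag hm ht i hi hj, h1, mul_zero]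
  rw [coeff_dworkQuartic_pow]
  refine Finset.sum_eq_zero fun k hk => if_neg fun h => ?_
  simp only [Finset.mem_piAntidiag, Fintype.sum_option, Fin.sum_univ_four] at hk
  have hlt (i : Fin 4) : d i ≤ 4 * m := by have := hd i; omega
  rcases exponents_eq (k (some 0)) (k (some 1)) (k (some 2)) (k (some 3)) (k none) m
    (h 0 ▸ hlt 0) (h 1 ▸ hlt 1) (h 2 ▸ hlt 2) (h 3 ▸ hlt 3) (by omega) with h | h | h | h | h
  · refine hdiag fun i => ?_
    fin_cases i <;> grind
  · refine hoff ⟨0, ?_, fun j hj => ?_⟩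
    · grind
    · fin_cases j <;> grind
  · refine hoff ⟨1, ?_, fun j hj => ?_⟩
    · grind
    · fin_cases j <;> grind
  · refine hoff ⟨2, ?_, fun j hj => ?_⟩
    · grind
    · fin_cases j <;> grind
  · refine hoff ⟨3, ?_, fun j hj => ?_⟩
    · grind
    · fin_cases j <;> grind

end Expansion

section Smooth

open MvPolynomial

variable {K : Type*} [Field K]

theorem radical_dworkQuartic (h2 : (2 : K) ≠ 0) {lam : K} (hlam : lam ^ 4 ≠ 256) :
    (Ideal.span {dworkQuartic lam, pderiv 0 (dworkQuartic lam), pderiv 1 (dworkQuartic lam),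
      pderiv 2 (dworkQuartic lam), pderiv 3 (dworkQuartic lam)}).radical =
      Ideal.span {(X 0 : MvPolynomial (Fin 4) K), X 1, X 2, X 3} := by
  have d0 : pderiv 0 (dworkQuartic lam) = 4 * X 0 ^ 3 + C lam * (X 1 * X 2 * X 3) := by
    simp [dworkQuartic, pderiv_X, mul_assoc, mul_left_comm, -mul_eq_mul_left_iff]
    try ring
  have d1 : pderiv 1 (dworkQuartic lam) = 4 * X 1 ^ 3 + C lam * (X 0 * X 2 * X 3) := by
    simp [dworkQuartic, pderiv_X, mul_assoc, mul_left_comm, -mul_eq_mul_left_iff]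
    try ring
  have d2 : pderiv 2 (dworkQuartic lam) = 4 * X 2 ^ 3 + C lam * (X 0 * X 1 * X 3) := by
    simp [dworkQuartic, pderiv_X, mul_assoc, mul_left_comm, -mul_eq_mul_left_iff]
    try ring
  have d3 : pderiv 3 (dworkQuartic lam) = 4 * X 3 ^ 3 + C lam * (X 0 * X 1 * X 2) := by
    simp [dworkQuartic, pderiv_X, mul_assoc, mul_left_comm, -mul_eq_mul_left_iff]
    try ring
  set I := Ideal.span {dworkQuartic lam, pderiv 0 (dworkQuartic lam), pderiv 1 (dworkQuartic lam),
      pderiv 2 (dworkQuartic lam), pderiv 3 (dworkQuartic lam)} with hI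
  have hker : RingHom.ker (constantCoeff : MvPolynomial (Fin 4) K →+* K) =
      Ideal.span {(X 0 : MvPolynomial (Fin 4) K), X 1, X 2, X 3} := by
    have hset : ({X 0, X 1, X 2, X 3} : Set (MvPolynomial (Fin 4) K)) = X '' Set.univ := by
      ext g
      simp [Fin.exists_fin_succ, eq_comm]
    ext g
    rw [hset, mem_ideal_span_X_image, RingHom.mem_ker, constantCoeff_eq]
    constructor
    · intro h s hs
      by_contra! hcon
      have : s = 0 := Finsupp.ext fun i => hcon i (Set.mem_univ i)
      rw [mem_support_iff, this] at hs
      exact hs h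
    · intro h
      by_contra hcon
      obtain ⟨i, -, hi⟩ := h 0 (mem_support_iff.mpr hcon)
      exact hi rfl
  apply le_antisymm
  · rw [← hker]
    have hprime : (RingHom.ker (constantCoeff : MvPolynomial (Fin 4) K →+* K)).IsPrime :=
      RingHom.ker_isPrime _
    rw [hprime.radical_le_iff, hI, Ideal.span_le]
    rintro g (rfl | rfl | rfl | rfl | rfl) <;>
      simp [RingHom.mem_ker, d0, d1, d2, d3, show constantCoeff (dworkQuartic lam) = 0 by
        simp [dworkQuartic]]
  · have hmem (g : MvPolynomial (Fin 4) K) (hg : g ∈ I) : Ideal.Quotient.mk I g = 0 :=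
      Ideal.Quotient.eq_zero_iff_mem.mpr hg
    have e0 := hmem _ (d0 ▸ Ideal.subset_span (by simp) :
      4 * X 0 ^ 3 + C lam * (X 1 * X 2 * X 3) ∈ I)
    have e1 := hmem _ (d1 ▸ Ideal.subset_span (by simp) :
      4 * X 1 ^ 3 + C lam * (X 0 * X 2 * X 3) ∈ I)
    have e2 := hmem _ (d2 ▸ Ideal.subset_span (by simp) :
      4 * X 2 ^ 3 + C lam * (X 0 * X 1 * X 3) ∈ I)
    have e3 := hmem _ (d3 ▸ Ideal.subset_span (by simp) :
      4 * X 3 ^ 3 + C lam * (X 0 * X 1 * X 2) ∈ I)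
    simp only [map_add, map_mul, map_pow, map_ofNat] at e0 e1 e2 e3
    have hunit (c : K) (hc : c ≠ 0) :
        Ideal.Quotient.mk I (C c⁻¹) * Ideal.Quotient.mk I (C c) = 1 := by
      rw [← map_mul, ← C_mul, inv_mul_cancel₀ hc, C_1, map_one]
    have h256 := hunit (256 - lam ^ 4) (sub_ne_zero.mpr hlam.symm)
    have h4 := hunit (2 ^ 2) (pow_ne_zero _ h2)
    simp only [map_sub, map_pow, map_ofNat] at h256 h4
    generalize Ideal.Quotient.mk I (C (256 - lam ^ 4)⁻¹) = r at h256
    generalize Ideal.Quotient.mk I (C (2 ^ 2)⁻¹) = q at h4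
    generalize Ideal.Quotient.mk I (C lam) = l at e0 e1 e2 e3 h256
    set x0 := Ideal.Quotient.mk I (X 0)
    set x1 := Ideal.Quotient.mk I (X 1)
    set x2 := Ideal.Quotient.mk I (X 2)
    set x3 := Ideal.Quotient.mk I (X 3)
    set P := x0 * x1 * x2 * x3 with hPdef
    have h0 : 4 * x0 ^ 4 = -l * P := by linear_combination x0 * e0
    have h1 : 4 * x1 ^ 4 = -l * P := by linear_combination x1 * e1
    have h2' : 4 * x2 ^ 4 = -l * P := by linear_combination x2 * e2
    have h3 : 4 * x3 ^ 4 = -l * P := by linear_combination x3 * e3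
    have key (i : Fin 4) : Ideal.Quotient.mk I (X i) ^ 16 = 0 := by
      have hP : (4 * Ideal.Quotient.mk I (X i) ^ 4) = -l * P := by
        fin_cases i
        exacts [h0, h1, h2', h3]
      have hP4 : P ^ 4 = 0 := by
        have : 256 * P ^ 4 = l ^ 4 * P ^ 4 := by
          calc 256 * P ^ 4 = (4 * x0 ^ 4) * (4 * x1 ^ 4) * (4 * x2 ^ 4) * (4 * x3 ^ 4) := by
                rw [hPdef]; ring
            _ = l ^ 4 * P ^ 4 := by rw [h0, h1, h2', h3]; ring
        linear_combination r * this - P ^ 4 * h256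
      have h16 : (4 * Ideal.Quotient.mk I (X i) ^ 4) ^ 4 = 0 := by
        rw [hP, mul_pow, hP4, mul_zero]
      have hq : (q * 2 ^ 2) ^ 4 = 1 := by rw [h4, one_pow]
      linear_combination q ^ 4 * h16 - Ideal.Quotient.mk I (X i) ^ 16 * hq
    rw [Ideal.span_le]
    have key' (i : Fin 4) : X i ∈ I.radical :=
      ⟨16, Ideal.Quotient.eq_zero_iff_mem.mp (by rw [map_pow, key])⟩
    rintro g (rfl | rfl | rfl | rfl) <;> exact key' _

end Smooth

open MvPolynomial

theorem stmt_10 (p : ℕ) [hp : Fact p.Prime] (hmod : p % 4 = 1) (hp5 : 5 < p) :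
    let K := AlgebraicClosure (ZMod p)
    let x : MvPolynomial (Fin 4) K := X 0
    let y : MvPolynomial (Fin 4) K := X 1
    let z : MvPolynomial (Fin 4) K := X 2
    let w : MvPolynomial (Fin 4) K := X 3
    ∃ lam : K,
      (x ^ 4 + y ^ 4 + z ^ 4 + w ^ 4 + C lam * (x * y * z * w)) ^ (p - 2) ∈
          Ideal.span {x ^ p, y ^ p, z ^ p, w ^ p} ∧
      (Ideal.span {x ^ 4 + y ^ 4 + z ^ 4 + w ^ 4 + C lam * (x * y * z * w),
          pderiv 0 (x ^ 4 + y ^ 4 + z ^ 4 + w ^ 4 + C lam * (x * y * z * w)),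
          pderiv 1 (x ^ 4 + y ^ 4 + z ^ 4 + w ^ 4 + C lam * (x * y * z * w)),
          pderiv 2 (x ^ 4 + y ^ 4 + z ^ 4 + w ^ 4 + C lam * (x * y * z * w)),
          pderiv 3 (x ^ 4 + y ^ 4 + z ^ 4 + w ^ 4 + C lam * (x * y * z * w))}).radical =
        Ideal.span {x, y, z, w} := by
  intro K x y z w
  have : CharP K p := charP_of_injective_algebraMap (algebraMap (ZMod p) K).injective p
  obtain ⟨m, hm⟩ : ∃ m, p = 4 * m + 1 := ⟨p / 4, by omega⟩
  obtain ⟨t, ht0, ht1, hT0, hT1⟩ := exists_double_root (K := K) hm hp5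
  obtain ⟨lam, hlam⟩ := IsAlgClosed.exists_pow_nat_eq (t⁻¹) (n := 4) (by norm_num)
  have h2 : (2 : K) ≠ 0 := by
    exact_mod_cast cast_ne_zero_of_lt (K := K) (p := p) (n := 2) (by omega) (by omega)
  have ht : lam ^ 4 * t = 1 := by rw [hlam, inv_mul_cancel₀ ht0]
  exact ⟨lam, dworkQuartic_pow_mem hm ht hT0 hT1,
    radical_dworkQuartic h2 fun h => ht1 (by rw [← h, ht])⟩
end

section
/- Let f = x⁴ + x·y³ + y·z³ + z·w³ in 𝔽₂[x,y,z,w,t], let Δ(f) = x⁵y³ + x⁴yz³ + x⁴zw³ + xy⁴z³ + xy³zw³ + yz⁴w³, and for an integer m ≥ 256 set g = f + t^m and Δ(g) = Δ(f) + t^m·f (the sum of the pairwise products of the five monomials of g). Then g·Δ(g)^{2⁸−1} = g·Δ(g)^{255} lies in the ideal (x^{512}, y^{512}, z^{512}, w^{512}, t^{512}). -/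
open MvPolynomial

section FedderChain

variable {R : Type*} [CommRing R]

/-- The monomial with exponent vector `(i, j, k, l)` in the four elements `v`. -/
def quadMonomial (v : Fin 4 → R) (i j k l : ℕ) : R :=
  v 0 ^ i * v 1 ^ j * v 2 ^ k * v 3 ^ l

/-- The quartic `x⁴ + xy³ + yz³ + zw³`. -/
def quartic (v : Fin 4 → R) : R :=
  v 0 ^ 4 + v 0 * v 1 ^ 3 + v 1 * v 2 ^ 3 + v 2 * v 3 ^ 3

/-- The sum of the pairwise products of the monomials of `quartic`. -/
def quarticDelta (v : Fin 4 → R) : R :=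
  v 0 ^ 5 * v 1 ^ 3 + v 0 ^ 4 * v 1 * v 2 ^ 3 + v 0 ^ 4 * v 2 * v 3 ^ 3 +
    v 0 * v 1 ^ 4 * v 2 ^ 3 + v 0 * v 1 ^ 3 * v 2 * v 3 ^ 3 + v 1 * v 2 ^ 4 * v 3 ^ 3

/-- The bracket ideal generated by the `q`-th powers. -/
def bracketIdeal (v : Fin 4 → R) (q : ℕ) : Ideal R :=
  Ideal.span {v 0 ^ q, v 1 ^ q, v 2 ^ q, v 3 ^ q}

/-- A sufficient combinatorial condition for a monomial to be multiplied into the bracket ideal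
of exponent `2 ^ (n + 1)` by `quarticDelta ^ (2 ^ n - 1)`. -/
def deltaNull : ℕ → ℕ → ℕ → ℕ → ℕ → Bool
  | 0, i, j, k, l => decide (2 ≤ i ∨ 2 ≤ j ∨ 2 ≤ k ∨ 2 ≤ l)
  | n + 1, i, j, k, l => decide (5 ≤ i + j + k + l) ||
      (deltaNull n ((i + 5) / 2) ((j + 3) / 2) (k / 2) (l / 2) &&
      deltaNull n ((i + 4) / 2) ((j + 1) / 2) ((k + 3) / 2) (l / 2) &&
      deltaNull n ((i + 4) / 2) (j / 2) ((k + 1) / 2) ((l + 3) / 2) &&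
      deltaNull n ((i + 1) / 2) ((j + 4) / 2) ((k + 3) / 2) (l / 2) &&
      deltaNull n ((i + 1) / 2) ((j + 3) / 2) ((k + 1) / 2) ((l + 3) / 2) &&
      deltaNull n (i / 2) ((j + 1) / 2) ((k + 4) / 2) ((l + 3) / 2))

theorem pow_mem_bracketIdeal (v : Fin 4 → R) (q : ℕ) (s : Fin 4) :
    v s ^ q ∈ bracketIdeal v q := by
  apply Ideal.subset_span
  fin_cases s <;> simp

theorem sup_pow_add_add_one_le (I J : Ideal R) (n m : ℕ) :
    (I ⊔ J) ^ (n + m + 1) ≤ I ^ (n + 1) ⊔ J ^ (m + 1) := by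
  rw [← Ideal.add_eq_sup, ← Ideal.add_eq_sup, add_pow, Ideal.sum_eq_sup]
  apply Finset.sup_le
  intro i _
  refine Ideal.mul_le_left.trans ?_
  rcases Nat.lt_or_ge n i with h | h
  · exact Ideal.mul_le_left.trans ((Ideal.pow_le_pow_right h).trans le_sup_left)
  · exact Ideal.mul_le_right.trans ((Ideal.pow_le_pow_right (by omega)).trans le_sup_right)

theorem span_range_pow_le_bracketIdeal (v : Fin 4 → R) (q : ℕ) :
    Ideal.span (Set.range v) ^ (4 * q + 1) ≤ bracketIdeal v (q + 1) := by
  have h : Ideal.span (Set.range v) = Ideal.span {v 0} ⊔ (Ideal.span {v 1} ⊔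
      (Ideal.span {v 2} ⊔ Ideal.span {v 3})) := by
    rw [← Ideal.span_union, ← Ideal.span_union, ← Ideal.span_union]
    congr 1
    ext a
    simp [Fin.exists_fin_succ, eq_comm]
    tauto
  have hs (s : Fin 4) : Ideal.span {v s} ^ (q + 1) ≤ bracketIdeal v (q + 1) := by
    rw [Ideal.span_singleton_pow, Ideal.span_singleton_le_iff_mem]
    exact pow_mem_bracketIdeal v _ s
  rw [h]
  have h₂ := (sup_pow_add_add_one_le (Ideal.span {v 2}) (Ideal.span {v 3}) q q).trans
    (sup_le (hs 2) (hs 3))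
  have h₁ := (sup_pow_add_add_one_le (Ideal.span {v 1}) (Ideal.span {v 2} ⊔ Ideal.span {v 3})
    q (q + q)).trans (sup_le (hs 1) h₂)
  have h₀ := (sup_pow_add_add_one_le (Ideal.span {v 0})
    (Ideal.span {v 1} ⊔ (Ideal.span {v 2} ⊔ Ideal.span {v 3})) q (q + (q + q))).trans
    (sup_le (hs 0) h₁)
  convert h₀ using 2
  omega

theorem sq_mem_bracketIdeal [CharP R 2] (v : Fin 4 → R) {q : ℕ} {a : R}
    (ha : a ∈ bracketIdeal v q) : a ^ 2 ∈ bracketIdeal v (q * 2) := by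
  have h := Ideal.mem_map_of_mem (frobenius R 2) ha
  rw [bracketIdeal, Ideal.map_span] at h
  simpa [Set.image_insert_eq, frobenius_def, ← pow_mul, bracketIdeal] using h

theorem quadMonomial_mem_pow (v : Fin 4 → R) (i j k l : ℕ) :
    quadMonomial v i j k l ∈ Ideal.span (Set.range v) ^ (i + j + k + l) := by
  have h (s : Fin 4) (e : ℕ) : v s ^ e ∈ Ideal.span (Set.range v) ^ e :=
    Ideal.pow_mem_pow (Ideal.subset_span (Set.mem_range_self s)) e
  simp only [pow_add]
  exact Ideal.mul_mem_mul (Ideal.mul_mem_mul (Ideal.mul_mem_mul (h 0 i) (h 1 j)) (h 2 k)) (h 3 l)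

theorem quarticDelta_eq (v : Fin 4 → R) :
    quarticDelta v = quadMonomial v 5 3 0 0 + quadMonomial v 4 1 3 0 + quadMonomial v 4 0 1 3 +
      quadMonomial v 1 4 3 0 + quadMonomial v 1 3 1 3 + quadMonomial v 0 1 4 3 := by
  simp [quarticDelta, quadMonomial]

theorem quarticDelta_mem_pow (v : Fin 4 → R) :
    quarticDelta v ∈ Ideal.span (Set.range v) ^ 8 := by
  rw [quarticDelta_eq]
  exact add_mem (add_mem (add_mem (add_mem (add_mem (quadMonomial_mem_pow v 5 3 0 0)
    (quadMonomial_mem_pow v 4 1 3 0)) (quadMonomial_mem_pow v 4 0 1 3))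
    (quadMonomial_mem_pow v 1 4 3 0)) (quadMonomial_mem_pow v 1 3 1 3))
    (quadMonomial_mem_pow v 0 1 4 3)

theorem quadMonomial_mul (v : Fin 4 → R) (i j k l i' j' k' l' : ℕ) :
    quadMonomial v i j k l * quadMonomial v i' j' k' l' =
      quadMonomial v (i + i') (j + j') (k + k') (l + l') := by
  simp only [quadMonomial]
  ring

theorem quadMonomial_eq_mul_sq (v : Fin 4 → R) (i j k l : ℕ) :
    quadMonomial v i j k l = quadMonomial v (i % 2) (j % 2) (k % 2) (l % 2) *
      quadMonomial v (i / 2) (j / 2) (k / 2) (l / 2) ^ 2 := by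
  rw [sq, quadMonomial_mul, quadMonomial_mul]
  congr 1 <;> omega

/-- Doubling step: squares of elements multiplied into one bracket ideal are multiplied into
the next one. -/
theorem sq_mul_pow_mem [CharP R 2] (v : Fin 4 → R) {n : ℕ} {d a : R}
    (ha : a * d ^ (2 ^ n - 1) ∈ bracketIdeal v (2 ^ (n + 1))) :
    a ^ 2 * d ^ (2 ^ (n + 1) - 2) ∈ bracketIdeal v (2 ^ (n + 2)) := by
  have h := sq_mem_bracketIdeal v ha
  rw [← pow_succ, mul_pow, ← pow_mul] at h
  convert h using 3
  rw [pow_succ]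
  omega

theorem mul_pow_mem_of_mul_mul_pow_mem {I : Ideal R} {n : ℕ} {d a : R}
    (ha : a * d * d ^ (2 ^ (n + 1) - 2) ∈ I) : a * d ^ (2 ^ (n + 1) - 1) ∈ I := by
  convert ha using 1
  rw [mul_assoc, ← pow_succ']
  congr 2
  have := Nat.one_le_two_pow (n := n)
  rw [pow_succ]
  omega

theorem quadMonomial_mul_pow_mem_of_half [CharP R 2] (v : Fin 4 → R) {n i j k l : ℕ} {d : R}
    (h : quadMonomial v (i / 2) (j / 2) (k / 2) (l / 2) * d ^ (2 ^ n - 1) ∈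
      bracketIdeal v (2 ^ (n + 1))) :
    quadMonomial v i j k l * d ^ (2 ^ (n + 1) - 2) ∈ bracketIdeal v (2 ^ (n + 2)) := by
  rw [quadMonomial_eq_mul_sq, mul_assoc]
  exact Ideal.mul_mem_left _ _ (sq_mul_pow_mem v h)

theorem quadMonomial_mul_pow_mem_of_five_le (v : Fin 4 → R) (n : ℕ) {i j k l : ℕ}
    (h : 5 ≤ i + j + k + l) :
    quadMonomial v i j k l * quarticDelta v ^ (2 ^ n - 1) ∈ bracketIdeal v (2 ^ (n + 1)) := by
  have h₁ := Ideal.mul_mem_mul (Ideal.pow_le_pow_right h (quadMonomial_mem_pow v i j k l))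
    (Ideal.pow_mem_pow (quarticDelta_mem_pow v) (2 ^ n - 1))
  rw [← pow_mul, ← pow_add] at h₁
  have hn := Nat.one_le_two_pow (n := n)
  obtain ⟨q, hq⟩ : ∃ q, 2 ^ (n + 1) = q + 1 := ⟨2 ^ (n + 1) - 1, by rw [pow_succ]; omega⟩
  rw [hq]
  refine span_range_pow_le_bracketIdeal v q (Ideal.pow_le_pow_right ?_ h₁)
  rw [pow_succ] at hq
  omega

theorem quadMonomial_mul_pow_mem_of_deltaNull [CharP R 2] (v : Fin 4 → R) (n i j k l : ℕ)
    (h : deltaNull n i j k l = true) :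
    quadMonomial v i j k l * quarticDelta v ^ (2 ^ n - 1) ∈ bracketIdeal v (2 ^ (n + 1)) := by
  induction n generalizing i j k l with
  | zero =>
    have hv (s : Fin 4) {e : ℕ} (he : 2 ≤ e) : v s ^ e ∈ bracketIdeal v 2 :=
      Ideal.mem_of_dvd _ (pow_dvd_pow _ he) (pow_mem_bracketIdeal v 2 s)
    simp only [deltaNull, decide_eq_true_eq] at h
    simp only [pow_zero, Nat.sub_self, mul_one, zero_add, pow_one, quadMonomial]
    rcases h with h | h | h | h
    · exact Ideal.mul_mem_right _ _ (Ideal.mul_mem_right _ _ (Ideal.mul_mem_right _ _ (hv 0 h)))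
    · exact Ideal.mul_mem_right _ _ (Ideal.mul_mem_right _ _ (Ideal.mul_mem_left _ _ (hv 1 h)))
    · exact Ideal.mul_mem_right _ _ (Ideal.mul_mem_left _ _ (hv 2 h))
    · exact Ideal.mul_mem_left _ _ (hv 3 h)
  | succ n ih =>
    simp only [deltaNull, Bool.or_eq_true, decide_eq_true_eq, Bool.and_eq_true] at h
    rcases h with h | ⟨⟨⟨⟨⟨h₁, h₂⟩, h₃⟩, h₄⟩, h₅⟩, h₆⟩
    · exact quadMonomial_mul_pow_mem_of_five_le v _ h
    · apply mul_pow_mem_of_mul_mul_pow_mem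
      nth_rw 1 [quarticDelta_eq]
      simp only [mul_add, add_mul, quadMonomial_mul]
      exact add_mem (add_mem (add_mem (add_mem (add_mem
        (quadMonomial_mul_pow_mem_of_half v (ih _ _ _ _ h₁))
        (quadMonomial_mul_pow_mem_of_half v (ih _ _ _ _ h₂)))
        (quadMonomial_mul_pow_mem_of_half v (ih _ _ _ _ h₃)))
        (quadMonomial_mul_pow_mem_of_half v (ih _ _ _ _ h₄)))
        (quadMonomial_mul_pow_mem_of_half v (ih _ _ _ _ h₅)))
        (quadMonomial_mul_pow_mem_of_half v (ih _ _ _ _ h₆))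

theorem quadMonomial_mul_pow_mem_of_deltaNull_half [CharP R 2] (v : Fin 4 → R) (n i j k l : ℕ)
    (h : deltaNull n (i / 2) (j / 2) (k / 2) (l / 2) = true) :
    quadMonomial v i j k l * quarticDelta v ^ (2 ^ (n + 1) - 2) ∈ bracketIdeal v (2 ^ (n + 2)) :=
  quadMonomial_mul_pow_mem_of_half v (quadMonomial_mul_pow_mem_of_deltaNull v _ _ _ _ _ h)

/-- Modulo `2`, the product of `quartic` and `quarticDelta` is a sum of sixteen monomials. -/
theorem quartic_mul_quarticDelta [CharP R 2] (v : Fin 4 → R) :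
    quartic v * quarticDelta v =
      quadMonomial v 9 3 0 0 + quadMonomial v 8 1 3 0 + quadMonomial v 8 0 1 3 +
      quadMonomial v 6 6 0 0 + quadMonomial v 2 7 3 0 + quadMonomial v 2 6 1 3 +
      quadMonomial v 4 2 6 0 + quadMonomial v 1 5 6 0 + quadMonomial v 0 2 7 3 +
      quadMonomial v 4 0 2 6 + quadMonomial v 1 3 2 6 + quadMonomial v 0 1 5 6 +
      quadMonomial v 5 4 3 0 + quadMonomial v 5 3 1 3 + quadMonomial v 4 1 4 3 +
      quadMonomial v 1 4 4 3 := by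
  simp only [quartic, quarticDelta, quadMonomial]
  linear_combination (v 0 ^ 5 * v 1 ^ 4 * v 2 ^ 3 + v 0 ^ 5 * v 1 ^ 3 * v 2 * v 3 ^ 3 +
    v 0 ^ 4 * v 1 * v 2 ^ 4 * v 3 ^ 3 + v 0 * v 1 ^ 4 * v 2 ^ 4 * v 3 ^ 3) *
      (CharTwo.two_eq_zero : (2 : R) = 0)

theorem quartic_mul_pow_mem [CharP R 2] (v : Fin 4 → R) {n : ℕ}
    (hn : deltaNull n 2 1 0 1 = true) :
    quartic v * quarticDelta v ^ (2 ^ (n + 1) - 1) ∈ bracketIdeal v (2 ^ (n + 2)) := by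
  apply mul_pow_mem_of_mul_mul_pow_mem
  have h (i j k l : ℕ) (hd : 5 ≤ i / 2 + j / 2 + k / 2 + l / 2) :
      quadMonomial v i j k l * quarticDelta v ^ (2 ^ (n + 1) - 2) ∈
        bracketIdeal v (2 ^ (n + 2)) :=
    quadMonomial_mul_pow_mem_of_half v (quadMonomial_mul_pow_mem_of_five_le v n hd)
  rw [quartic_mul_quarticDelta]
  simp only [add_mul]
  have h₀ := quadMonomial_mul_pow_mem_of_deltaNull_half v n 5 3 1 3 hn
  repeat' apply add_mem
  all_goals first
    | exact h₀
    | exact h _ _ _ _ (by norm_num)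

theorem quarticDelta_add_sq_mul_pow_mem [CharP R 2] (v : Fin 4 → R) :
    (quarticDelta v + quartic v ^ 2) * quarticDelta v ^ 254 ∈ bracketIdeal v 512 := by
  rw [add_mul]
  refine add_mem ?_ (sq_mul_pow_mem v (n := 7) (quartic_mul_pow_mem v (n := 6) (by decide)))
  nth_rw 1 [quarticDelta_eq]
  simp only [add_mul]
  repeat' apply add_mem
  all_goals exact quadMonomial_mul_pow_mem_of_deltaNull_half v 7 _ _ _ _ (by decide)

/-- Multiplying a perturbed element: if `T ^ 2` lies in `J`, only the terms of order at most one
in `T` matter. -/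
theorem add_mul_add_mul_pow_mem [CharP R 2] {J : Ideal R} {f d T : R} {n : ℕ} (hT : T ^ 2 ∈ J)
    (h₁ : f * d ^ (2 * n + 1) ∈ J) (h₂ : T * ((d + f ^ 2) * d ^ (2 * n)) ∈ J) :
    (f + T) * (d + T * f) ^ (2 * n + 1) ∈ J := by
  obtain ⟨c, hc⟩ := sq_dvd_add_pow_sub_sub (T * f) d (2 * n + 1)
  have h2 : (2 : R) = 0 := CharTwo.two_eq_zero
  have key : (f + T) * (d + T * f) ^ (2 * n + 1) = f * d ^ (2 * n + 1) +
      T * ((d + f ^ 2) * d ^ (2 * n)) + T ^ 2 * ((f + T) * f ^ 2 * c + f * d ^ (2 * n)) := by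
    push_cast at hc
    linear_combination (f + T) * hc + (f + T) * d ^ (2 * n) * (T * f) * n * h2
  rw [key]
  exact add_mem (add_mem h₁ h₂) (Ideal.mul_mem_right _ _ hT)

end FedderChain

theorem stmt_12 (m : ℕ) (hm : 256 ≤ m) :
    let x : MvPolynomial (Fin 5) (ZMod 2) := X 0
    let y : MvPolynomial (Fin 5) (ZMod 2) := X 1
    let z : MvPolynomial (Fin 5) (ZMod 2) := X 2
    let w : MvPolynomial (Fin 5) (ZMod 2) := X 3
    let t : MvPolynomial (Fin 5) (ZMod 2) := X 4
    let f : MvPolynomial (Fin 5) (ZMod 2) := x ^ 4 + x * y ^ 3 + y * z ^ 3 + z * w ^ 3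
    let Δf : MvPolynomial (Fin 5) (ZMod 2) :=
      x ^ 5 * y ^ 3 + x ^ 4 * y * z ^ 3 + x ^ 4 * z * w ^ 3 +
        x * y ^ 4 * z ^ 3 + x * y ^ 3 * z * w ^ 3 + y * z ^ 4 * w ^ 3
    let g : MvPolynomial (Fin 5) (ZMod 2) := f + t ^ m
    let Δg : MvPolynomial (Fin 5) (ZMod 2) := Δf + t ^ m * f
    g * Δg ^ 255 ∈
      Ideal.span {x ^ 512, y ^ 512, z ^ 512, w ^ 512, t ^ 512} := by
  intro x y z w t f Δf g Δg
  let v : Fin 4 → MvPolynomial (Fin 5) (ZMod 2) := ![x, y, z, w]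
  have hle : bracketIdeal v 512 ≤ Ideal.span {x ^ 512, y ^ 512, z ^ 512, w ^ 512, t ^ 512} := by
    apply Ideal.span_mono
    intro a ha
    simp only [Set.mem_insert_iff, Set.mem_singleton_iff] at ha ⊢
    rcases ha with h | h | h | h <;> simp [h, v]
  have hf : f = quartic v := rfl
  have hΔ : Δf = quarticDelta v := rfl
  have hT : (t ^ m) ^ 2 ∈ Ideal.span {x ^ 512, y ^ 512, z ^ 512, w ^ 512, t ^ 512} := by
    rw [← pow_mul]
    exact Ideal.mem_of_dvd _ (pow_dvd_pow t (by omega : 512 ≤ m * 2))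
      (Ideal.subset_span (by simp))
  refine add_mul_add_mul_pow_mem (n := 127) hT ?_ ?_
  · rw [hf, hΔ]
    exact hle (quartic_mul_pow_mem v (n := 7) (by decide))
  · rw [hf, hΔ]
    exact Ideal.mul_mem_left _ _ (hle (quarticDelta_add_sq_mul_pow_mem v))
end
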